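/- arXiv:1903.11635 — 2 statements merged into one kernel-verified Lean document; each statement's English description precedes it below -/
import Mathlib

section
/- For every constant c > 0 there exists a constant K > 0 such that the following holds for all n ≥ 1: if w₀, w₁, …, w_n are real numbers with Σ_{i=0}^n w_i² = 1 and |w_i| ≤ c/√n for all 0 ≤ i ≤ n, then the linear threshold function f(x) = sign(w₀ + Σ_{i=1}^n w_i x_i) satisfies H(f) ≤ K·Inf(f). -/
open Finset Real MeasureTheory ProbabilityTheory
open scoped Classical

/-- sign: maps z to 1 if z > 0 and to −1 if z ≤ 0. -/
noncomputable def sgn (z : ℝ) : ℝ := if 0 < z then 1 else -1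

/-- interpret a Bool as ±1. -/
def pm (b : Bool) : ℝ := if b then 1 else -1

/-- probability of an event under the uniform distribution on {−1,1}^n. -/
noncomputable def unifPr (n : ℕ) (E : (Fin n → Bool) → Prop) : ℝ :=
  ((Finset.univ : Finset (Fin n → Bool)).filter E).card / 2 ^ n

/-- expectation under the uniform distribution on {−1,1}^n. -/
noncomputable def unifExp (n : ℕ) (g : (Fin n → Bool) → ℝ) : ℝ :=
  (∑ x : Fin n → Bool, g x) / 2 ^ n

/-- flip the i-th coordinate. -/
def flipAt {n : ℕ} (i : Fin n) (x : Fin n → Bool) : Fin n → Bool :=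
  Function.update x i (!(x i))

/-- influence of coordinate i. -/
noncomputable def infl {n : ℕ} (f : (Fin n → Bool) → ℝ) (i : Fin n) : ℝ :=
  unifPr n (fun x => f x ≠ f (flipAt i x))

/-- total influence. -/
noncomputable def totalInfl {n : ℕ} (f : (Fin n → Bool) → ℝ) : ℝ :=
  ∑ i, infl f i

/-- Fourier coefficient f̂(S). -/
noncomputable def fCoeff {n : ℕ} (f : (Fin n → Bool) → ℝ) (S : Finset (Fin n)) : ℝ :=
  unifExp n (fun x => f x * ∏ i ∈ S, pm (x i))

/-- Fourier entropy with log base 2 (0 · log(1/0) is 0 by convention, which holds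
definitionally since `Real.log 0 = 0` in Mathlib). -/
noncomputable def fourierEntropy {n : ℕ} (f : (Fin n → Bool) → ℝ) : ℝ :=
  ∑ S : Finset (Fin n), (fCoeff f S) ^ 2 * Real.logb 2 (1 / (fCoeff f S) ^ 2)

/-- The linear threshold function with weights w₀, w₁, …, w_n. -/
noncomputable def ltf (n : ℕ) (w : Fin (n + 1) → ℝ) : (Fin n → Bool) → ℝ :=
  fun x => sgn (w 0 + ∑ i : Fin n, w i.succ * pm (x i))


lemma pm_not (b : Bool) : pm (!b) = - pm b := by cases b <;> simp [pm]
lemma pm_sq (b : Bool) : pm b * pm b = 1 := by cases b <;> simp [pm]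
lemma pm_abs (b : Bool) : |pm b| = 1 := by cases b <;> simp [pm]
lemma sgn_sq (z : ℝ) : sgn z * sgn z = 1 := by unfold sgn; split_ifs <;> norm_num
lemma sgn_mul_self (z : ℝ) : sgn z * z = |z| := by
  unfold sgn
  split_ifs with h
  · rw [abs_of_pos h]; ring
  · rw [abs_of_nonpos (not_lt.mp h)]; ring
lemma sgn_cases (z : ℝ) : sgn z = 1 ∨ sgn z = -1 := by unfold sgn; split_ifs <;> simp

/-- flip all the coordinates in `B` -/
def flipS {n : ℕ} (B : Finset (Fin n)) (x : Fin n → Bool) : Fin n → Bool :=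
  fun i => if i ∈ B then !(x i) else x i

lemma flipS_flipS {n : ℕ} (B : Finset (Fin n)) (x : Fin n → Bool) :
    flipS B (flipS B x) = x := by
  funext i
  unfold flipS
  by_cases h : i ∈ B <;> simp [h]

lemma flipAt_eq {n : ℕ} (i : Fin n) (x : Fin n → Bool) : flipAt i x = flipS {i} x := by
  funext k
  unfold flipAt flipS
  by_cases h : k = i
  · subst h; simp
  · simp [h]

lemma sum_flipS {n : ℕ} (B : Finset (Fin n)) (g : (Fin n → Bool) → ℝ) :
    ∑ x, g (flipS B x) = ∑ x, g x :=
  Equiv.sum_comp (Function.Involutive.toPerm (flipS B) (flipS_flipS B)) g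

/-- the sign of a coordinate -/
def epsB {n : ℕ} (B : Finset (Fin n)) (i : Fin n) : ℝ := if i ∈ B then -1 else 1

lemma pm_flipS {n : ℕ} (B : Finset (Fin n)) (x : Fin n → Bool) (i : Fin n) :
    pm (flipS B x i) = epsB B i * pm (x i) := by
  unfold flipS epsB
  by_cases h : i ∈ B <;> simp [h, pm_not]

lemma orth {n : ℕ} (B : Finset (Fin n)) (x y : Fin n → Bool) :
    ∏ i, (1 + epsB B i * pm (x i) * pm (y i)) = if y = flipS B x then 2 ^ n else 0 := by
  split_ifs with h
  · subst h
    have : ∀ i, (1 + epsB B i * pm (x i) * pm (flipS B x i)) = 2 := by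
      intro i
      rw [pm_flipS]
      have := pm_sq (x i)
      have h2 : epsB B i * epsB B i = 1 := by unfold epsB; split_ifs <;> norm_num
      linear_combination (epsB B i * epsB B i) * this + h2
    simp [this]
  · obtain ⟨i, hi⟩ := Function.ne_iff.mp h
    apply Finset.prod_eq_zero (Finset.mem_univ i)
    have : pm (y i) = - pm (flipS B x i) := by
      have : y i = ! (flipS B x i) := by
        revert hi; cases y i <;> cases flipS B x i <;> simp
      rw [this, pm_not]
    rw [this, pm_flipS]
    have := pm_sq (x i)
    have h2 : epsB B i * epsB B i = 1 := by unfold epsB; split_ifs <;> norm_num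
    linear_combination -(epsB B i * epsB B i) * this - h2

lemma plancherel {n : ℕ} (B : Finset (Fin n)) (f : (Fin n → Bool) → ℝ) :
    ∑ S : Finset (Fin n), (fCoeff f S) ^ 2 * ∏ i ∈ S, epsB B i
      = (∑ x, f x * f (flipS B x)) / 2 ^ n := by
  have h1 : ∀ S : Finset (Fin n), (fCoeff f S) ^ 2 * ∏ i ∈ S, epsB B i
      = (∑ x, ∑ y, f x * f y * ∏ i ∈ S, (epsB B i * pm (x i) * pm (y i))) / (2 ^ n * 2 ^ n) := by
    intro S
    unfold fCoeff unifExp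
    rw [sq, div_mul_div_comm, Finset.sum_mul_sum, div_mul_eq_mul_div, Finset.sum_mul]
    congr 1
    apply Finset.sum_congr rfl; intro x _
    rw [Finset.sum_mul]
    apply Finset.sum_congr rfl; intro y _
    rw [Finset.prod_mul_distrib, Finset.prod_mul_distrib]
    ring
  rw [Finset.sum_congr rfl (fun S _ => h1 S), ← Finset.sum_div, Finset.sum_comm]
  have h2 : ∀ x : Fin n → Bool, ∑ S : Finset (Fin n), ∑ y, f x * f y * ∏ i ∈ S, (epsB B i * pm (x i) * pm (y i))
      = f x * f (flipS B x) * 2 ^ n := by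
    intro x
    rw [Finset.sum_comm]
    have : ∀ y : Fin n → Bool, ∑ S : Finset (Fin n), f x * f y * ∏ i ∈ S, (epsB B i * pm (x i) * pm (y i))
        = if y = flipS B x then f x * f y * 2 ^ n else 0 := by
      intro y
      rw [← Finset.mul_sum]
      have h := orth B x y
      rw [Finset.prod_one_add, Finset.powerset_univ] at h
      rw [h]
      split_ifs <;> simp
    rw [Finset.sum_congr rfl (fun y _ => this y)]
    simp
  rw [Finset.sum_congr rfl (fun x _ => h2 x), ← Finset.sum_mul]
  field_simp

lemma parseval {n : ℕ} (f : (Fin n → Bool) → ℝ) (hf : ∀ x, f x * f x = 1) :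
    ∑ S : Finset (Fin n), (fCoeff f S) ^ 2 = 1 := by
  have h := plancherel (∅ : Finset (Fin n)) f
  have e : ∀ x : Fin n → Bool, flipS ∅ x = x := by intro x; funext i; simp [flipS]
  simp only [e, hf] at h
  simpa [epsB] using h

/-- block linear form -/
noncomputable def blk {n m : ℕ} (w : Fin (n+1) → ℝ) (β : Fin n → Fin m) (j : Fin m)
    (x : Fin n → Bool) : ℝ := ∑ i with β i = j, w i.succ * pm (x i)

/-- the block -/
def blkSet {n m : ℕ} (β : Fin n → Fin m) (j : Fin m) : Finset (Fin n) := {i | β i = j}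

lemma blk_flip_self {n m : ℕ} (w : Fin (n+1) → ℝ) (β : Fin n → Fin m) (j : Fin m)
    (x : Fin n → Bool) : blk w β j (flipS (blkSet β j) x) = - blk w β j x := by
  unfold blk
  rw [← Finset.sum_neg_distrib]
  apply Finset.sum_congr rfl
  intro i hi
  have hi : β i = j := by simpa using hi
  rw [pm_flipS]
  simp [epsB, blkSet, hi]

lemma blk_flip_ne {n m : ℕ} (w : Fin (n+1) → ℝ) (β : Fin n → Fin m) (j k : Fin m) (hjk : k ≠ j)
    (x : Fin n → Bool) : blk w β k (flipS (blkSet β j) x) = blk w β k x := by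
  unfold blk
  apply Finset.sum_congr rfl
  intro i hi
  have hi : β i = k := by simpa using hi
  rw [pm_flipS]
  simp [epsB, blkSet, hi, hjk]

lemma ltf_blk {n m : ℕ} (w : Fin (n+1) → ℝ) (β : Fin n → Fin m) (x : Fin n → Bool) :
    ltf n w x = sgn (w 0 + ∑ j, blk w β j x) := by
  unfold ltf blk
  rw [Finset.sum_fiberwise]

lemma pointwise (L R : ℝ) :
    1 - sgn (L + R) * sgn (-L + R) = Real.sign L * (sgn (L + R) - sgn (-L + R)) := by
  rcases lt_trichotomy L 0 with h | h | h
  · rw [Real.sign_of_neg h]; unfold sgn; split_ifs <;> first | (exfalso; linarith) | norm_num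
  · subst h; simp [sgn_sq]
  · rw [Real.sign_of_pos h]; unfold sgn; split_ifs <;> first | (exfalso; linarith) | norm_num

lemma block_bound {n m : ℕ} (w : Fin (n+1) → ℝ) (β : Fin n → Fin m) :
    ∑ j : Fin m, ∑ x, (1 - ltf n w x * ltf n w (flipS (blkSet β j) x)) ≤ 2 * (Real.sqrt m * 2 ^ n) := by
  have h1 : ∀ j : Fin m, ∑ x, (1 - ltf n w x * ltf n w (flipS (blkSet β j) x))
      = 2 * ∑ x, ltf n w x * Real.sign (blk w β j x) := by
    intro j
    have a : ∀ x, 1 - ltf n w x * ltf n w (flipS (blkSet β j) x) =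
        ltf n w x * Real.sign (blk w β j x) +
          ltf n w (flipS (blkSet β j) x) * Real.sign (blk w β j (flipS (blkSet β j) x)) := by
      intro x
      rw [blk_flip_self, Real.sign_neg, ltf_blk w β x, ltf_blk w β (flipS _ x)]
      rw [← Finset.add_sum_erase _ _ (Finset.mem_univ j),
        ← Finset.add_sum_erase _ (fun k => blk w β k (flipS (blkSet β j) x)) (Finset.mem_univ j),
        blk_flip_self]
      have : ∑ k ∈ univ.erase j, blk w β k (flipS (blkSet β j) x) = ∑ k ∈ univ.erase j, blk w β k x := by
        apply Finset.sum_congr rfl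
        intro k hk
        exact blk_flip_ne w β j k (Finset.ne_of_mem_erase hk) x
      rw [this]
      have := pointwise (blk w β j x) (w 0 + ∑ k ∈ univ.erase j, blk w β k x)
      rw [show w 0 + (blk w β j x + ∑ k ∈ univ.erase j, blk w β k x) =
        blk w β j x + (w 0 + ∑ k ∈ univ.erase j, blk w β k x) by ring,
        show w 0 + (-blk w β j x + ∑ k ∈ univ.erase j, blk w β k x) =
        -blk w β j x + (w 0 + ∑ k ∈ univ.erase j, blk w β k x) by ring]
      linear_combination this
    rw [Finset.sum_congr rfl (fun x _ => a x), Finset.sum_add_distrib,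
      sum_flipS (blkSet β j) (fun x => ltf n w x * Real.sign (blk w β j x))]
    ring
  rw [Finset.sum_congr rfl (fun j _ => h1 j), ← Finset.mul_sum, Finset.sum_comm]
  simp only [← Finset.mul_sum]
  apply mul_le_mul_of_nonneg_left _ (by norm_num : (0:ℝ) ≤ 2)
  have hcs := Finset.sum_mul_sq_le_sq_mul_sq Finset.univ (ltf n w)
    (fun x => ∑ j : Fin m, Real.sign (blk w β j x))
  have hf : ∑ x, ltf n w x ^ 2 = 2 ^ n := by
    have : ∀ x, ltf n w x ^ 2 = 1 := fun x => by rw [sq]; exact sgn_sq _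
    simp [this]
  have hs : ∑ x, (∑ j : Fin m, Real.sign (blk w β j x)) ^ 2 ≤ m * 2 ^ n := by
    have e : ∀ j k : Fin m, ∑ x, Real.sign (blk w β j x) * Real.sign (blk w β k x)
        ≤ if j = k then 2 ^ n else 0 := by
      intro j k
      split_ifs with h
      · subst h
        calc ∑ x, Real.sign (blk w β j x) * Real.sign (blk w β j x) ≤ ∑ x : Fin n → Bool, 1 := by
              apply Finset.sum_le_sum; intro x _
              rcases Real.sign_apply_eq (blk w β j x) with h | h | h <;> rw [h] <;> norm_num
          _ = 2 ^ n := by simp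
      · have := sum_flipS (blkSet β j) (fun x => Real.sign (blk w β j x) * Real.sign (blk w β k x))
        simp only [blk_flip_self, blk_flip_ne w β j k (Ne.symm h), Real.sign_neg, neg_mul,
          Finset.sum_neg_distrib] at this
        linarith
    calc ∑ x, (∑ j : Fin m, Real.sign (blk w β j x)) ^ 2
        = ∑ j : Fin m, ∑ k : Fin m, ∑ x, Real.sign (blk w β j x) * Real.sign (blk w β k x) := by
          simp only [sq, Finset.sum_mul_sum]
          rw [Finset.sum_comm]
          apply Finset.sum_congr rfl; intro j _
          rw [Finset.sum_comm]
      _ ≤ ∑ j : Fin m, ∑ k : Fin m, if j = k then 2 ^ n else 0 :=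
          Finset.sum_le_sum fun j _ => Finset.sum_le_sum fun k _ => e j k
      _ = m * 2 ^ n := by simp
  rw [hf] at hcs
  refine abs_le_of_sq_le_sq' ?_ (by positivity) |>.2
  calc _ ≤ _ := hcs
    _ ≤ 2 ^ n * (m * 2 ^ n) := by gcongr
    _ = _ := by rw [mul_pow, Real.sq_sqrt (by positivity)]; ring

lemma ltf_sq {n : ℕ} (w : Fin (n+1) → ℝ) (x : Fin n → Bool) : ltf n w x * ltf n w x = 1 := sgn_sq _

lemma avg_eps {n m : ℕ} (hm : 0 < m) (j : Fin m) (S : Finset (Fin n)) :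
    ∑ β : Fin n → Fin m, ∏ i ∈ S, epsB (blkSet β j) i = (m:ℝ) ^ n * (1 - 2 / m) ^ S.card := by
  have hm' : (m:ℝ) ≠ 0 := by positivity
  have h1 : ∀ β : Fin n → Fin m, ∏ i ∈ S, epsB (blkSet β j) i
      = ∏ i, (fun (i : Fin n) (b : Fin m) => if i ∈ S then (if b = j then (-1:ℝ) else 1) else 1) i (β i) := by
    intro β
    simp [epsB, blkSet, Finset.prod_ite_mem]
  rw [Finset.sum_congr rfl (fun β _ => h1 β)]
  have := Finset.sum_prod_piFinset (Finset.univ : Finset (Fin m))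
    (fun (i : Fin n) (b : Fin m) => if i ∈ S then (if b = j then (-1:ℝ) else 1) else 1)
  rw [Fintype.piFinset_univ] at this
  rw [this]
  have h2 : ∀ i : Fin n, ∑ b : Fin m, (if i ∈ S then (if b = j then (-1:ℝ) else 1) else 1)
      = m * (if i ∈ S then (1 - 2 / (m:ℝ)) else 1) := by
    intro i
    split_ifs with h
    · have : ∀ b : Fin m, (if b = j then (-1:ℝ) else 1) = 1 - (if b = j then 2 else 0) := by
        intro b; split_ifs <;> norm_num
      rw [Finset.sum_congr rfl (fun b _ => this b), Finset.sum_sub_distrib]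
      simp
      field_simp
    · simp
  rw [Finset.prod_congr rfl (fun i _ => h2 i), Finset.prod_mul_distrib]
  simp [Finset.prod_ite_mem]

lemma peres {n m : ℕ} (hm : 0 < m) (w : Fin (n+1) → ℝ) :
    ∑ S : Finset (Fin n), (fCoeff (ltf n w) S) ^ 2 * (1 - (1 - 2 / (m:ℝ)) ^ S.card) * m
      ≤ 2 * Real.sqrt m := by
  have hm' : (0:ℝ) < m := by positivity
  have h1 : ∀ β : Fin n → Fin m, ∑ j : Fin m, ∑ S : Finset (Fin n),
      (fCoeff (ltf n w) S) ^ 2 * (1 - ∏ i ∈ S, epsB (blkSet β j) i) ≤ 2 * Real.sqrt m := by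
    intro β
    have hb := block_bound w β
    have e : ∀ j : Fin m, ∑ S : Finset (Fin n),
      (fCoeff (ltf n w) S) ^ 2 * (1 - ∏ i ∈ S, epsB (blkSet β j) i) =
        (∑ x, (1 - ltf n w x * ltf n w (flipS (blkSet β j) x))) / 2 ^ n := by
      intro j
      simp only [mul_sub, mul_one, Finset.sum_sub_distrib]
      rw [plancherel, parseval _ (ltf_sq w)]
      simp [sub_div]
    rw [Finset.sum_congr rfl (fun j _ => e j), ← Finset.sum_div, div_le_iff₀ (by positivity)]
    linarith
  have h2 : ∑ β : Fin n → Fin m, ∑ j : Fin m, ∑ S : Finset (Fin n),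
      (fCoeff (ltf n w) S) ^ 2 * (1 - ∏ i ∈ S, epsB (blkSet β j) i)
      ≤ (m:ℝ) ^ n * (2 * Real.sqrt m) := by
    calc _ ≤ ∑ β : Fin n → Fin m, 2 * Real.sqrt m := Finset.sum_le_sum fun β _ => h1 β
      _ = _ := by simp
  have h3 : ∑ β : Fin n → Fin m, ∑ j : Fin m, ∑ S : Finset (Fin n),
      (fCoeff (ltf n w) S) ^ 2 * (1 - ∏ i ∈ S, epsB (blkSet β j) i)
      = (m:ℝ) ^ n * ∑ S : Finset (Fin n), (fCoeff (ltf n w) S) ^ 2 * (1 - (1 - 2 / (m:ℝ)) ^ S.card) * m := by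
    rw [Finset.sum_comm]
    have : ∀ j : Fin m, ∑ β : Fin n → Fin m, ∑ S : Finset (Fin n),
      (fCoeff (ltf n w) S) ^ 2 * (1 - ∏ i ∈ S, epsB (blkSet β j) i)
      = (m:ℝ) ^ n * ∑ S : Finset (Fin n), (fCoeff (ltf n w) S) ^ 2 * (1 - (1 - 2 / (m:ℝ)) ^ S.card) := by
      intro j
      rw [Finset.sum_comm, Finset.mul_sum]
      apply Finset.sum_congr rfl; intro S _
      rw [← Finset.mul_sum, Finset.sum_sub_distrib, avg_eps hm]
      simp
      ring
    rw [Finset.sum_congr rfl (fun j _ => this j)]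
    simp [← Finset.sum_mul]
    ring
  rw [h3] at h2
  exact le_of_mul_le_mul_left h2 (by positivity)

lemma tail {n k : ℕ} (hk : 1 ≤ k) (w : Fin (n+1) → ℝ) :
    ∑ S : Finset (Fin n), (if k ≤ S.card then (fCoeff (ltf n w) S) ^ 2 else 0) ≤ 4 / Real.sqrt k := by
  have hk' : (1:ℝ) ≤ k := by exact_mod_cast hk
  have hp := peres (m := 2 * k) (by omega) w
  have e : (2:ℝ) / ((2 * k : ℕ) : ℝ) = 1 / k := by push_cast; field_simp
  rw [e] at hp
  have hb0 : (0:ℝ) ≤ 1 - 1 / k := by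
    rw [sub_nonneg, div_le_one (by linarith)]; exact hk'
  have hb1 : (1:ℝ) - 1 / k ≤ 1 := by
    have : (0:ℝ) ≤ 1 / k := by positivity
    linarith
  have hhalf : ((1:ℝ) - 1 / k) ^ k ≤ 1 / 2 := by
    refine (Real.one_sub_div_pow_le_exp_neg hk').trans ?_
    rw [Real.exp_neg, inv_eq_one_div]
    have := Real.add_one_le_exp 1
    apply one_div_le_one_div_of_le <;> linarith
  have h1 : ∑ S : Finset (Fin n), (if k ≤ S.card then (fCoeff (ltf n w) S) ^ 2 else 0) * k
      ≤ 2 * Real.sqrt ((2 * k : ℕ) : ℝ) := by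
    refine le_trans (Finset.sum_le_sum fun S _ => ?_) hp
    push_cast
    have hq : (0:ℝ) ≤ (fCoeff (ltf n w) S) ^ 2 := sq_nonneg _
    have h0 : (1 - 1 / (k:ℝ)) ^ S.card ≤ 1 := pow_le_one₀ hb0 hb1
    split_ifs with h
    · have : (1 - 1 / (k:ℝ)) ^ S.card ≤ 1 / 2 := (pow_le_pow_of_le_one hb0 hb1 h).trans hhalf
      nlinarith [mul_nonneg hq (by linarith : (0:ℝ) ≤ k)]
    · rw [zero_mul]
      exact mul_nonneg (mul_nonneg hq (by linarith)) (by linarith)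
  rw [← Finset.sum_mul] at h1
  have h2 : Real.sqrt ((2 * k : ℕ) : ℝ) ≤ 2 * Real.sqrt k := by
    rw [Real.sqrt_le_left (by positivity), mul_pow, Real.sq_sqrt (by linarith)]
    push_cast; linarith
  have hs : 0 < Real.sqrt k := Real.sqrt_pos.mpr (by linarith)
  have hss : Real.sqrt k * Real.sqrt k = k := Real.mul_self_sqrt (by linarith)
  rw [le_div_iff₀ hs]
  have : (∑ S : Finset (Fin n), (if k ≤ S.card then (fCoeff (ltf n w) S) ^ 2 else 0)) * Real.sqrt k * Real.sqrt k
      ≤ 4 * Real.sqrt k := by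
    rw [mul_assoc, hss]; linarith
  exact le_of_mul_le_mul_right this hs

/-- fourth root -/
noncomputable def qrt (k : ℕ) : ℝ := Real.sqrt (Real.sqrt k)

lemma qrt_nonneg (k : ℕ) : 0 ≤ qrt k := Real.sqrt_nonneg _
lemma qrt_sq (k : ℕ) : qrt k ^ 2 = Real.sqrt k := Real.sq_sqrt (Real.sqrt_nonneg _)
lemma qrt_four (k : ℕ) : qrt k ^ 4 = k := by
  rw [show qrt k ^ 4 = (qrt k ^ 2) ^ 2 by ring, qrt_sq, Real.sq_sqrt (by positivity)]
lemma qrt_pos {k : ℕ} (h : 1 ≤ k) : 0 < qrt k :=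
  Real.sqrt_pos.mpr (Real.sqrt_pos.mpr (by exact_mod_cast h))
lemma qrt_mono {j k : ℕ} (h : j ≤ k) : qrt j ≤ qrt k :=
  Real.sqrt_le_sqrt (Real.sqrt_le_sqrt (by exact_mod_cast h))

lemma sum_qrt (n : ℕ) : ∑ j ∈ Finset.Icc 1 n, 1 / qrt j ^ 3 ≤ 4 * qrt n := by
  induction n with
  | zero => simp [qrt]
  | succ n ih =>
    rw [Finset.sum_Icc_succ_top (by omega)]
    have hb : 0 < qrt (n+1) := qrt_pos (by omega)
    have ha := qrt_nonneg n
    have hab : qrt n ≤ qrt (n+1) := qrt_mono (by omega)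
    have e : qrt (n+1) ^ 4 = qrt n ^ 4 + 1 := by rw [qrt_four, qrt_four]; push_cast; ring
    generalize qrt (n+1) = b at *
    generalize qrt n = a at *
    have : 1 / b ^ 3 ≤ 4 * (b - a) := by
      rw [div_le_iff₀ (by positivity)]
      have h3 : a ^ 3 ≤ b ^ 3 := pow_le_pow_left₀ ha hab 3
      have h2 : a ^ 2 * b ≤ b ^ 3 := by nlinarith [pow_le_pow_left₀ ha hab 2]
      have h1 : a * b ^ 2 ≤ b ^ 3 := by nlinarith [sq_nonneg b]
      have : 1 = (b - a) * (b ^ 3 + a * b ^ 2 + a ^ 2 * b + a ^ 3) := by linear_combination -e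
      rw [this]
      nlinarith [sub_nonneg.mpr hab]
    linarith

lemma log_choose {n k : ℕ} (hk : k ≤ n) :
    Real.log (n.choose k) ≤ 4 * qrt n * (k / qrt k) := by
  rcases Nat.eq_zero_or_pos k with h0 | h0
  · subst h0; simp
  have hk0 : (0:ℝ) < k := by exact_mod_cast h0
  have hn0 : (0:ℝ) < n := by exact_mod_cast (lt_of_lt_of_le h0 hk)
  have hc : (0:ℝ) < n.choose k := by exact_mod_cast Nat.choose_pos hk
  have h1 : (n.choose k : ℝ) * ((k:ℝ) / n) ^ k ≤ Real.exp k := by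
    have h2 : ((k:ℝ) / n + 1) ^ n ≤ Real.exp k := by
      calc ((k:ℝ) / n + 1) ^ n ≤ (Real.exp ((k:ℝ) / n)) ^ n :=
            pow_le_pow_left₀ (by positivity) (Real.add_one_le_exp _) n
        _ = Real.exp k := by rw [← Real.exp_nat_mul]; congr 1; field_simp
    refine le_trans ?_ h2
    rw [add_pow]
    have := Finset.single_le_sum (f := fun m => ((k:ℝ) / n) ^ m * 1 ^ (n - m) * (n.choose m : ℝ))
      (s := Finset.range (n+1)) (fun i _ => by positivity) (Finset.mem_range.mpr (by omega : k < n+1))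
    simp only [one_pow, mul_one] at this ⊢
    linarith
  have h3 := Real.log_le_log (by positivity) h1
  rw [Real.log_exp, Real.log_mul (by positivity) (by positivity), Real.log_pow] at h3
  have ha := qrt_pos h0
  have hb := qrt_pos (k := n) (by omega)
  have h4 : Real.log ((k:ℝ) / n) = - (4 * Real.log (qrt n / qrt k)) := by
    rw [← qrt_four n, ← qrt_four k, ← div_pow, Real.log_pow, Real.log_div (by positivity) (by positivity),
      Real.log_div (by positivity) (by positivity)]
    push_cast; ring
  rw [h4] at h3
  have h5 := Real.log_le_sub_one_of_pos (div_pos hb ha)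
  have h6 : (k:ℝ) * Real.log (qrt n / qrt k) ≤ k * (qrt n / qrt k - 1) := by gcongr
  have h7 : 4 * qrt n * (k / qrt k) = 4 * (k * (qrt n / qrt k)) := by ring
  rw [h7]
  nlinarith

lemma layer {n k : ℕ} (hk : k ≤ n) :
    (k:ℝ) / qrt k ≤ ∑ j ∈ Finset.Icc 1 n, (if j ≤ k then 1 / qrt j else 0) := by
  calc (k:ℝ) / qrt k = ∑ j ∈ Finset.Icc 1 k, 1 / qrt k := by simp [div_eq_mul_inv]
    _ ≤ ∑ j ∈ Finset.Icc 1 k, (if j ≤ k then 1 / qrt j else 0) := by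
        apply Finset.sum_le_sum; intro j hj
        rw [Finset.mem_Icc] at hj
        rw [if_pos hj.2]
        exact one_div_le_one_div_of_le (qrt_pos hj.1) (qrt_mono hj.2)
    _ ≤ _ := by
        apply Finset.sum_le_sum_of_subset_of_nonneg
        · exact Finset.Icc_subset_Icc le_rfl hk
        · intro j _ _
          have := qrt_nonneg j
          split_ifs <;> positivity

lemma gibbs (p q : ℝ) (hp : 0 ≤ p) (hq : 0 < q) :
    p * Real.log (1 / p) ≤ p * Real.log (1 / q) + q - p := by
  rcases hp.eq_or_lt with h | h
  · subst h; simp; exact hq.le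
  · have := Real.log_le_sub_one_of_pos (div_pos hq h)
    rw [Real.log_div hq.ne' h.ne'] at this
    rw [one_div, one_div, Real.log_inv, Real.log_inv]
    have h2 := mul_le_mul_of_nonneg_left this hp
    have : p * (q / p - 1) = q - p := by field_simp
    nlinarith

lemma entropy_bound {n : ℕ} (hn : 1 ≤ n) (w : Fin (n+1) → ℝ) :
    fourierEntropy (ltf n w) ≤ 132 * Real.sqrt n := by
  have hn' : (1:ℝ) ≤ n := by exact_mod_cast hn
  set p : Finset (Fin n) → ℝ := fun S => (fCoeff (ltf n w) S) ^ 2 with hpdef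
  have hp0 : ∀ S, 0 ≤ p S := fun S => sq_nonneg _
  have hp1 : ∑ S, p S = 1 := parseval _ (ltf_sq w)
  let q : ℕ → ℝ := fun k => 1 / ((n + 1) * (n.choose k : ℝ))
  have hcard : ∀ S : Finset (Fin n), S.card ≤ n := fun S => by
    simpa using Finset.card_le_univ S
  have hc : ∀ S : Finset (Fin n), (0:ℝ) < (n.choose S.card : ℝ) := fun S => by
    exact_mod_cast Nat.choose_pos (hcard S)
  have hq1 : ∑ S : Finset (Fin n), q S.card = 1 := by
    have := Finset.sum_powerset_apply_card q (x := (Finset.univ : Finset (Fin n)))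
    rw [Finset.powerset_univ] at this
    rw [this]
    have e : ∀ k ∈ Finset.range ((Finset.univ : Finset (Fin n)).card + 1),
        ((Finset.univ : Finset (Fin n)).card.choose k) • q k = 1 / ((n:ℝ) + 1) := by
      intro k hk
      simp only [Finset.card_univ, Fintype.card_fin, Finset.mem_range] at hk ⊢
      have : (0:ℝ) < n.choose k := by exact_mod_cast Nat.choose_pos (by omega)
      simp only [q, nsmul_eq_mul]
      field_simp
    rw [Finset.sum_congr rfl e]
    simp
    field_simp
  have hlogq : ∀ S : Finset (Fin n), Real.log (1 / q S.card) = Real.log (n + 1) + Real.log (n.choose S.card) := by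
    intro S
    simp only [q, one_div_one_div]
    rw [Real.log_mul (by positivity) (hc S).ne']
  have hA : ∑ S, p S * Real.log (1 / p S) ≤
      Real.log (n+1) + ∑ S, p S * Real.log (n.choose S.card) := by
    calc ∑ S, p S * Real.log (1 / p S)
        ≤ ∑ S, (p S * Real.log (1 / q S.card) + q S.card - p S) := by
          apply Finset.sum_le_sum; intro S _
          apply gibbs _ _ (hp0 S)
          have := hc S
          simp only [q]; positivity
      _ = _ := by
          rw [Finset.sum_sub_distrib, Finset.sum_add_distrib, hp1, hq1]
          simp only [hlogq, mul_add, Finset.sum_add_distrib, ← Finset.sum_mul, hp1]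
          ring
  have hB : ∑ S, p S * (S.card / qrt S.card) ≤ 16 * qrt n := by
    calc ∑ S, p S * (S.card / qrt S.card)
        ≤ ∑ S : Finset (Fin n), p S * ∑ j ∈ Finset.Icc 1 n, (if j ≤ S.card then 1 / qrt j else 0) := by
          apply Finset.sum_le_sum; intro S _
          exact mul_le_mul_of_nonneg_left (layer (hcard S)) (hp0 S)
      _ = ∑ j ∈ Finset.Icc 1 n, 1 / qrt j * ∑ S : Finset (Fin n), (if j ≤ S.card then p S else 0) := by
          simp only [Finset.mul_sum]
          rw [Finset.sum_comm]
          apply Finset.sum_congr rfl; intro j _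
          apply Finset.sum_congr rfl; intro S _
          split_ifs
          · ring
          · simp
      _ ≤ ∑ j ∈ Finset.Icc 1 n, 4 * (1 / qrt j ^ 3) := by
          apply Finset.sum_le_sum; intro j hj
          rw [Finset.mem_Icc] at hj
          have hq := qrt_pos hj.1
          calc _ ≤ 1 / qrt j * (4 / Real.sqrt j) :=
                mul_le_mul_of_nonneg_left (tail hj.1 w) (by positivity)
            _ = _ := by rw [← qrt_sq]; field_simp
      _ ≤ 16 * qrt n := by
          rw [← Finset.mul_sum]
          linarith [sum_qrt n]
  have hC : ∑ S, p S * Real.log (n.choose S.card) ≤ 64 * Real.sqrt n := by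
    calc ∑ S, p S * Real.log (n.choose S.card)
        ≤ ∑ S : Finset (Fin n), 4 * qrt n * (p S * (S.card / qrt S.card)) := by
          apply Finset.sum_le_sum; intro S _
          have := mul_le_mul_of_nonneg_left (log_choose (hcard S)) (hp0 S)
          linarith
      _ ≤ 4 * qrt n * (16 * qrt n) := by
          rw [← Finset.mul_sum]
          exact mul_le_mul_of_nonneg_left hB (by have := qrt_nonneg n; positivity)
      _ = _ := by rw [← qrt_sq]; ring
  have hs1 : 1 ≤ Real.sqrt n := Real.one_le_sqrt.mpr hn'
  have hss : Real.sqrt n ^ 2 = n := Real.sq_sqrt (by linarith)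
  have hD : Real.log (n+1) ≤ 2 * Real.sqrt n := by
    have h1 : (n:ℝ) + 1 ≤ (Real.sqrt n + 1) ^ 2 := by nlinarith
    have h2 := Real.log_le_log (by positivity) h1
    rw [Real.log_pow] at h2
    have h3 := Real.log_le_sub_one_of_pos (show 0 < Real.sqrt n + 1 by linarith)
    push_cast at h2
    linarith
  have hE : fourierEntropy (ltf n w) = (∑ S, p S * Real.log (1 / p S)) / Real.log 2 := by
    unfold fourierEntropy Real.logb
    rw [Finset.sum_div]
    apply Finset.sum_congr rfl; intro S _
    ring
  have hl2 : (1:ℝ) / 2 < Real.log 2 := by linarith [Real.log_two_gt_d9]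
  rw [hE, div_le_iff₀ (by linarith)]
  nlinarith

lemma infl_eq {n : ℕ} (f : (Fin n → Bool) → ℝ) (i : Fin n) :
    infl f i = ((Finset.univ.filter (fun x => f x ≠ f (flipAt i x))).card : ℝ) / 2 ^ n := by
  unfold infl unifPr
  congr!

/-- partial linear form -/
noncomputable def lin {n : ℕ} (a : ℝ) (v : Fin n → ℝ) (T : Finset (Fin n)) (x : Fin n → Bool) : ℝ :=
  a + ∑ i ∈ T, v i * pm (x i)

lemma lin_flip {n : ℕ} (a : ℝ) (v : Fin n → ℝ) (T : Finset (Fin n)) (i : Fin n) (hi : i ∉ T)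
    (x : Fin n → Bool) : lin a v T (flipS {i} x) = lin a v T x := by
  unfold lin
  congr 1
  apply Finset.sum_congr rfl
  intro k hk
  have : k ≠ i := fun h => hi (h ▸ hk)
  simp [pm_flipS, epsB, this]

lemma lin_insert {n : ℕ} (a : ℝ) (v : Fin n → ℝ) (T : Finset (Fin n)) (i : Fin n) (hi : i ∉ T)
    (x : Fin n → Bool) : lin a v (insert i T) x = lin a v T x + v i * pm (x i) := by
  unfold lin
  rw [Finset.sum_insert hi]; ring

lemma lin_insert_flip {n : ℕ} (a : ℝ) (v : Fin n → ℝ) (T : Finset (Fin n)) (i : Fin n) (hi : i ∉ T)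
    (x : Fin n → Bool) : lin a v (insert i T) (flipS {i} x) = lin a v T x - v i * pm (x i) := by
  rw [lin_insert a v T i hi, lin_flip a v T i hi, pm_flipS]
  simp [epsB]; ring

lemma moments {n : ℕ} (a : ℝ) (v : Fin n → ℝ) (T : Finset (Fin n)) :
    (∑ x, lin a v T x ^ 2 = 2 ^ n * (a ^ 2 + ∑ i ∈ T, v i ^ 2)) ∧
    (∑ x, lin a v T x ^ 4 ≤ 2 ^ n * (3 * (a ^ 2 + ∑ i ∈ T, v i ^ 2) ^ 2)) := by
  induction T using Finset.induction_on with
  | empty =>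
    simp only [lin, Finset.sum_empty, add_zero, Finset.sum_const, Finset.card_univ, Fintype.card_pi,
      Fintype.card_bool, Finset.prod_const, Fintype.card_fin, nsmul_eq_mul]
    push_cast
    refine ⟨rfl, ?_⟩
    apply mul_le_mul_of_nonneg_left _ (by positivity)
    nlinarith [sq_nonneg (a ^ 2)]
  | insert i T hi ih =>
    obtain ⟨h2, h4⟩ := ih
    have e : ∀ x : Fin n → Bool, (v i * pm (x i)) ^ 2 = v i ^ 2 := by
      intro x; rw [mul_pow, sq (pm _), pm_sq, mul_one]
    rw [Finset.sum_insert hi]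
    set s := a ^ 2 + ∑ i ∈ T, v i ^ 2 with hs
    have hs0 : 0 ≤ s := add_nonneg (sq_nonneg _) (Finset.sum_nonneg fun i _ => sq_nonneg _)
    have hs' : a ^ 2 + (v i ^ 2 + ∑ i ∈ T, v i ^ 2) = s + v i ^ 2 := by rw [hs]; ring
    rw [hs']
    constructor
    · have f := sum_flipS {i} (fun x => lin a v (insert i T) x ^ 2)
      have g : ∑ x, (lin a v (insert i T) x ^ 2 + lin a v (insert i T) (flipS {i} x) ^ 2)
          = ∑ x, (2 * lin a v T x ^ 2 + 2 * v i ^ 2) := by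
        apply Finset.sum_congr rfl; intro x _
        rw [lin_insert_flip a v T i hi, lin_insert a v T i hi]
        linear_combination 2 * e x
      rw [Finset.sum_add_distrib, f, Finset.sum_add_distrib, ← Finset.mul_sum, h2] at g
      simp at g
      linarith
    · have f := sum_flipS {i} (fun x => lin a v (insert i T) x ^ 4)
      have g : ∑ x, (lin a v (insert i T) x ^ 4 + lin a v (insert i T) (flipS {i} x) ^ 4)
          = ∑ x, (2 * lin a v T x ^ 4 + 12 * v i ^ 2 * lin a v T x ^ 2 + 2 * v i ^ 4) := by
        apply Finset.sum_congr rfl; intro x _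
        rw [lin_insert_flip a v T i hi, lin_insert a v T i hi]
        linear_combination (12 * lin a v T x ^ 2 + 2 * ((v i * pm (x i)) ^ 2 + v i ^ 2)) * e x
      rw [Finset.sum_add_distrib, f, Finset.sum_add_distrib, Finset.sum_add_distrib,
        ← Finset.mul_sum, ← Finset.mul_sum, h2] at g
      simp at g
      have : (0:ℝ) ≤ 2 ^ n * v i ^ 4 := by positivity
      nlinarith

lemma abs_poly (z : ℝ) : z ^ 2 / 2 - z ^ 4 / 18 ≤ |z| := by
  have h2 : z ^ 2 = |z| ^ 2 := (sq_abs z).symm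
  have h4 : z ^ 4 = |z| ^ 4 := by rw [show z ^ 4 = (z ^ 2) ^ 2 by ring, h2]; ring
  rw [h2, h4]
  have h0 := abs_nonneg z
  generalize |z| = t at *
  have : 0 ≤ 1 - t / 2 + t ^ 3 / 18 := by nlinarith [mul_nonneg h0 (sq_nonneg (t - 2)), sq_nonneg (t - 2), sq_nonneg (t-1)]
  nlinarith [mul_nonneg h0 this]

lemma fCoeff_le_infl {n : ℕ} (w : Fin (n+1) → ℝ) (i : Fin n) :
    |∑ x, ltf n w x * pm (x i)| ≤ 2 ^ n * infl (ltf n w) i := by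
  have f := sum_flipS {i} (fun x => ltf n w x * pm (x i))
  have g : 2 * ∑ x, ltf n w x * pm (x i) = ∑ x, (ltf n w x - ltf n w (flipS {i} x)) * pm (x i) := by
    rw [two_mul]
    nth_rw 2 [← f]
    rw [← Finset.sum_add_distrib]
    apply Finset.sum_congr rfl; intro x _
    rw [pm_flipS]; simp [epsB]; ring
  have h : |∑ x, (ltf n w x - ltf n w (flipS {i} x)) * pm (x i)| ≤
      ∑ x, (if ltf n w x ≠ ltf n w (flipAt i x) then (2:ℝ) else 0) := by
    refine (Finset.abs_sum_le_sum_abs _ _).trans (Finset.sum_le_sum fun x _ => ?_)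
    rw [abs_mul, pm_abs, mul_one, flipAt_eq]
    split_ifs with h
    · rcases sgn_cases (w 0 + ∑ i : Fin n, w i.succ * pm (x i)) with h1 | h1 <;>
      rcases sgn_cases (w 0 + ∑ k : Fin n, w k.succ * pm (flipS {i} x k)) with h2 | h2 <;>
      simp only [ltf, h1, h2] <;> norm_num
    · push Not at h
      rw [h]; simp
  have e : 2 ^ n * infl (ltf n w) i * 2 = ∑ x, (if ltf n w x ≠ ltf n w (flipAt i x) then (2:ℝ) else 0) := by
    rw [infl_eq]
    rw [← Finset.sum_filter, Finset.sum_const, nsmul_eq_mul]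
    field_simp
  rw [← g, abs_mul, ← e] at h
  norm_num at h
  linarith

lemma infl_nonneg {n : ℕ} (f : (Fin n → Bool) → ℝ) (i : Fin n) : 0 ≤ infl f i := by
  unfold infl unifPr; positivity

lemma infl_lower {n : ℕ} (w : Fin (n+1) → ℝ) (τ : ℝ) (hw : ∑ i, w i ^ 2 = 1)
    (hτ : ∀ i, |w i| ≤ τ) : 1 / 3 ≤ τ * (1 + totalInfl (ltf n w)) := by
  have hτ0 : 0 ≤ τ := (abs_nonneg _).trans (hτ 0)
  obtain ⟨h2, h4⟩ := moments (w 0) (fun i : Fin n => w i.succ) Finset.univ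
  rw [Fin.sum_univ_succ] at hw
  rw [hw] at h2 h4
  have hz : ∀ x, ltf n w x * lin (w 0) (fun i : Fin n => w i.succ) Finset.univ x
      = |lin (w 0) (fun i : Fin n => w i.succ) Finset.univ x| := fun x => sgn_mul_self _
  have h5 : 2 ^ n * (1/3:ℝ) ≤ ∑ x, ltf n w x * lin (w 0) (fun i : Fin n => w i.succ) Finset.univ x := by
    rw [Finset.sum_congr rfl (fun x _ => hz x)]
    refine le_trans ?_ (Finset.sum_le_sum fun x _ => abs_poly _)
    rw [Finset.sum_sub_distrib, ← Finset.sum_div, ← Finset.sum_div, h2]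
    linarith
  have h6 : ∑ x, ltf n w x * lin (w 0) (fun i : Fin n => w i.succ) Finset.univ x
      = w 0 * ∑ x, ltf n w x + ∑ i : Fin n, w i.succ * ∑ x, ltf n w x * pm (x i) := by
    unfold lin
    simp only [mul_add, Finset.sum_add_distrib, Finset.mul_sum]
    congr 1
    · apply Finset.sum_congr rfl; intro x _; ring
    · rw [Finset.sum_comm]
      apply Finset.sum_congr rfl; intro i _
      apply Finset.sum_congr rfl; intro x _; ring
  have h7 : w 0 * ∑ x, ltf n w x ≤ τ * 2 ^ n := by
    refine (le_abs_self _).trans ?_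
    rw [abs_mul]
    apply mul_le_mul (hτ 0) _ (abs_nonneg _) hτ0
    refine (Finset.abs_sum_le_sum_abs _ _).trans ?_
    have : ∀ x, |ltf n w x| = 1 := by
      intro x
      rcases sgn_cases (w 0 + ∑ i : Fin n, w i.succ * pm (x i)) with h1 | h1 <;> simp [ltf, h1]
    simp [this]
  have h8 : ∑ i : Fin n, w i.succ * ∑ x, ltf n w x * pm (x i) ≤ ∑ i : Fin n, τ * (2 ^ n * infl (ltf n w) i) := by
    apply Finset.sum_le_sum; intro i _
    refine (le_abs_self _).trans ?_
    rw [abs_mul]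
    exact mul_le_mul (hτ _) (fCoeff_le_infl w i) (abs_nonneg _) hτ0
  rw [← Finset.mul_sum, ← Finset.mul_sum] at h8
  rw [h6] at h5
  unfold totalInfl
  have : 2 ^ n * (1/3:ℝ) ≤ 2 ^ n * (τ * (1 + ∑ i, infl (ltf n w) i)) := by linarith
  exact le_of_mul_le_mul_left this (by positivity)

lemma entropy_zero {n : ℕ} (f : (Fin n → Bool) → ℝ) (hf : ∀ x, f x * f x = 1)
    (h0 : ∀ i, infl f i = 0) : fourierEntropy f = 0 := by
  have h1 : ∀ i x, f (flipS {i} x) = f x := by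
    intro i x
    have := h0 i
    rw [infl_eq] at this
    rw [div_eq_zero_iff] at this
    have h := this.resolve_right (by positivity)
    rw [Nat.cast_eq_zero, Finset.card_eq_zero, Finset.filter_eq_empty_iff] at h
    have := h (Finset.mem_univ x)
    push Not at this
    rw [flipAt_eq] at this
    exact this.symm
  have h2 : ∀ S : Finset (Fin n), S ≠ ∅ → fCoeff f S = 0 := by
    intro S hS
    obtain ⟨i, hi⟩ := Finset.nonempty_iff_ne_empty.mpr hS
    unfold fCoeff unifExp
    have g := sum_flipS {i} (fun x => f x * ∏ k ∈ S, pm (x k))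
    have e : ∏ k ∈ S, epsB {i} k = -1 := by
      unfold epsB
      simp [Finset.prod_ite_eq', hi]
    simp only [h1, pm_flipS, Finset.prod_mul_distrib, e] at g
    simp only [neg_mul, one_mul, mul_neg, Finset.sum_neg_distrib] at g
    have : ∑ x, f x * ∏ k ∈ S, pm (x k) = 0 := by linarith
    rw [this]; simp
  have h3 := parseval f hf
  rw [Finset.sum_eq_single ∅ (fun S _ hS => by rw [h2 S hS]; norm_num) (by simp)] at h3
  unfold fourierEntropy
  apply Finset.sum_eq_zero
  intro S _
  by_cases hS : S = ∅
  · subst hS; rw [h3]; simp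
  · rw [h2 S hS]; simp

/-- FEI conjecture holds for τ-regular LTFs with τ ≤ c/√n. -/
theorem fei_tau_regular :
    ∀ c : ℝ, 0 < c → ∃ K : ℝ, 0 < K ∧ ∀ n : ℕ, 1 ≤ n → ∀ w : Fin (n + 1) → ℝ,
      (∑ i, w i ^ 2) = 1 → (∀ i, |w i| ≤ c / Real.sqrt n) →
      fourierEntropy (ltf n w) ≤ K * totalInfl (ltf n w) := by
  intro c hc
  set N : ℕ := ⌈(6 * c) ^ 2⌉₊ with hN
  refine ⟨132 * (6 * c) * 2 ^ N, by positivity, ?_⟩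
  intro n hn w hw hτ
  have hn' : (1:ℝ) ≤ n := by exact_mod_cast hn
  have hs1 : 1 ≤ Real.sqrt n := Real.one_le_sqrt.mpr hn'
  have hH := entropy_bound hn w
  have hI0 : 0 ≤ totalInfl (ltf n w) := Finset.sum_nonneg fun i _ => infl_nonneg _ i
  have hpow : (1:ℝ) ≤ 2 ^ N := one_le_pow₀ (by norm_num)
  rcases le_or_gt (6 * c) (Real.sqrt n) with h | h
  · have hl := infl_lower w _ hw hτ
    rw [div_mul_eq_mul_div, le_div_iff₀ (by linarith)] at hl
    have h1 : Real.sqrt n ≤ 6 * c * totalInfl (ltf n w) := by linarith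
    have h2 : 6 * c * totalInfl (ltf n w) * 1 ≤ 6 * c * totalInfl (ltf n w) * 2 ^ N :=
      mul_le_mul_of_nonneg_left hpow (by positivity)
    linarith
  · by_cases hz : ∀ i, infl (ltf n w) i = 0
    · rw [entropy_zero _ (ltf_sq w) hz]
      positivity
    · push Not at hz
      obtain ⟨i, hi⟩ := hz
      have h1 : 1 / 2 ^ n ≤ infl (ltf n w) i := by
        rw [infl_eq] at hi ⊢
        have : (Finset.univ.filter (fun x => ltf n w x ≠ ltf n w (flipAt i x))).card ≠ 0 := by
          intro h
          apply hi
          rw [h]; simp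
        have h2 : (1:ℝ) ≤ (Finset.univ.filter (fun x => ltf n w x ≠ ltf n w (flipAt i x))).card := by
          exact_mod_cast Nat.one_le_iff_ne_zero.mpr this
        gcongr
      have h2 : infl (ltf n w) i ≤ totalInfl (ltf n w) :=
        Finset.single_le_sum (fun k _ => infl_nonneg (ltf n w) k) (Finset.mem_univ i)
      have hnN : n ≤ N := by
        have h3 : (n:ℝ) ≤ (6 * c) ^ 2 := by
          rw [← Real.sq_sqrt (by linarith : (0:ℝ) ≤ n)]
          gcongr
        have := h3.trans (Nat.le_ceil _)
        exact_mod_cast this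
      have h4 : (1:ℝ) ≤ 2 ^ N * totalInfl (ltf n w) := by
        have h5 : (2:ℝ) ^ n ≤ 2 ^ N := pow_le_pow_right₀ (by norm_num) hnN
        have h6 := h1.trans h2
        rw [div_le_iff₀ (by positivity)] at h6
        have := mul_le_mul_of_nonneg_left h5 hI0
        linarith
      have h7 := mul_le_mul_of_nonneg_left h4 (by positivity : 0 ≤ 132 * (6 * c))
      linarith
end

section
/- Let a₁, …, a_n be real numbers, not all zero, let σ = √(Σ_{j=1}^n a_j²) and ℓ = (Σ_{j=1}^n |a_j|³)/σ³, and let Φ denote the cumulative distribution function of the standard normal distribution N(0,1). Then for every x ∈ ℝ, | Pr_{ε uniform on {−1,1}^n}[ Σ_{j=1}^n a_j ε_j < x·σ ] − Φ(x) | ≤ ℓ/√(2π) + 3.4106·ℓ^{4/3}. -/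
open Finset Real MeasureTheory ProbabilityTheory
open scoped Classical

theorem be_sin_lower (x : ℝ) (h0 : 0 ≤ x) (h1 : x ≤ π) : x * (1 - x / π) ≤ Real.sin x := by
  have key : ∀ x : ℝ, 0 ≤ x → x ≤ π/2 → x * (1 - x / π) ≤ Real.sin x := by
    intro x h0 h1
    refine le_trans ?_ (Real.sin_ge_sub_cube h0)
    have hp := Real.pi_pos
    have hp1 := Real.pi_gt_three
    have hp2 := Real.pi_lt_d2
    have : x / π ≥ x^2/6 := by
      rw [ge_iff_le, div_le_div_iff₀ (by norm_num) hp]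
      nlinarith [mul_nonneg h0 h0, mul_nonneg h0 hp.le]
    nlinarith
  rcases le_total x (π/2) with h | h
  · exact key x h0 h
  · have := key (π - x) (by linarith) (by linarith)
    rw [Real.sin_pi_sub] at this
    refine le_trans (le_of_eq ?_) this
    field_simp
    ring

/-- the Beurling / Prawitz kernel -/
noncomputable def beq (t : ℝ) : ℝ := (1 - t) * (Real.cos (π * t) / Real.sin (π * t)) + 1 / π

theorem be_cot_le (x : ℝ) (h0 : 0 < x) (h1 : x ≤ π / 2) : Real.cos x / Real.sin x ≤ 1 / x := by
  have hs : 0 < Real.sin x := Real.sin_pos_of_pos_of_lt_pi h0 (by linarith [Real.pi_pos])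
  rw [div_le_div_iff₀ hs h0, one_mul]
  rcases h1.lt_or_eq with h | h
  · have := Real.lt_tan h0 h
    have hc : 0 < Real.cos x := Real.cos_pos_of_mem_Ioo ⟨by linarith, h⟩
    rw [Real.tan_eq_sin_div_cos, lt_div_iff₀ hc] at this
    linarith
  · rw [h]; simp

theorem be_cot_ge (x : ℝ) (h0 : 0 < x) (h1 : x ≤ π / 2) : 1 / x - x / 2 ≤ Real.cos x / Real.sin x := by
  have hs : 0 < Real.sin x := Real.sin_pos_of_pos_of_lt_pi h0 (by linarith [Real.pi_pos])
  have hc : 0 ≤ Real.cos x := Real.cos_nonneg_of_mem_Icc ⟨by linarith, h1⟩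
  have h2 : Real.cos x / x ≤ Real.cos x / Real.sin x := by
    gcongr
    exact Real.sin_le h0.le
  refine le_trans ?_ h2
  rw [le_div_iff₀ h0]
  have := @Real.one_sub_sq_div_two_le_cos x
  refine le_trans (le_of_eq ?_) this
  field_simp

theorem be_cot_refl (t : ℝ) : Real.cos (π * t) / Real.sin (π * t) =
    - (Real.cos (π * (1 - t)) / Real.sin (π * (1 - t))) := by
  have : π * (1 - t) = π - π * t := by ring
  rw [this, Real.cos_pi_sub, Real.sin_pi_sub, neg_div, neg_neg]

theorem be_q_le (t : ℝ) (h0 : 0 < t) (h1 : t < 1) : beq t ≤ 1 / (π * t) := by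
  have hp := Real.pi_pos
  unfold beq
  rcases le_total t (1/2) with h | h
  · have := be_cot_le (π * t) (by positivity) (by nlinarith)
    have h2 : (1 - t) * (Real.cos (π * t) / Real.sin (π * t)) ≤ (1 - t) * (1 / (π * t)) :=
      mul_le_mul_of_nonneg_left this (by linarith)
    refine le_trans (add_le_add_left h2 _) (le_of_eq ?_)
    field_simp
    ring
  · have hc : Real.cos (π * t) ≤ 0 :=
      Real.cos_nonpos_of_pi_div_two_le_of_le (by nlinarith) (by nlinarith)
    have hs : 0 < Real.sin (π * t) := Real.sin_pos_of_pos_of_lt_pi (by positivity) (by nlinarith)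
    have h3 : Real.cos (π * t) / Real.sin (π * t) ≤ 0 := div_nonpos_of_nonpos_of_nonneg hc hs.le
    have h4 : 1 / π ≤ 1 / (π * t) := by
      apply one_div_le_one_div_of_le (by positivity)
      nlinarith
    nlinarith

theorem be_q_nonneg (t : ℝ) (h0 : 0 < t) (h1 : t < 1) : 0 ≤ beq t := by
  have hp := Real.pi_pos
  unfold beq
  rcases le_total t (1/2) with h | h
  · have hc : 0 ≤ Real.cos (π * t) :=
      Real.cos_nonneg_of_mem_Icc ⟨by nlinarith, by nlinarith⟩
    have hs : 0 < Real.sin (π * t) := Real.sin_pos_of_pos_of_lt_pi (by positivity) (by nlinarith)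
    have : 0 ≤ 1 - t := by linarith
    positivity
  · rw [be_cot_refl]
    have h2 : 0 < 1 - t := by linarith
    have := be_cot_le (π * (1 - t)) (by positivity) (by nlinarith)
    have h2 : (1 - t) * (Real.cos (π * (1-t)) / Real.sin (π * (1-t))) ≤ (1 - t) * (1 / (π * (1-t))) :=
      mul_le_mul_of_nonneg_left this (by linarith)
    have h3 : (1 - t) * (1 / (π * (1-t))) = 1 / π := by field_simp
    linarith

theorem be_q_ge (t : ℝ) (h0 : 0 < t) (h1 : t ≤ 1 / 2) : 1 / (π * t) - π / 2 * t ≤ beq t := by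
  have hp := Real.pi_pos
  unfold beq
  have := be_cot_ge (π * t) (by positivity) (by nlinarith)
  have h2 : (1 - t) * (1 / (π * t) - π * t / 2) ≤ (1 - t) * (Real.cos (π * t) / Real.sin (π * t)) :=
    mul_le_mul_of_nonneg_left this (by linarith)
  have h3 : (1 - t) * (1 / (π * t) - π * t / 2) + 1 / π =
      1 / (π * t) - π / 2 * t + π * t ^2 / 2 := by field_simp; ring
  have : 0 ≤ π * t ^2 / 2 := by positivity
  linarith

theorem be_q_le_right (t : ℝ) (h0 : 1 / 3 ≤ t) (h1 : t < 1) : beq t ≤ 5 / π * (1 - t) := by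
  have hp := Real.pi_pos
  have hp4 := Real.pi_lt_d2
  unfold beq
  rcases le_total t (1/2) with h | h
  · have := be_cot_le (π * t) (by positivity) (by nlinarith)
    have h2 : (1 - t) * (Real.cos (π * t) / Real.sin (π * t)) ≤ (1 - t) * (1 / (π * t)) :=
      mul_le_mul_of_nonneg_left this (by linarith)
    have h3 : 1 / (π * t) ≤ 3 / π := by
      rw [div_le_div_iff₀ (by positivity) hp]; nlinarith
    have h4 : (1 - t) * (1 / (π * t)) ≤ (1 - t) * (3 / π) :=
      mul_le_mul_of_nonneg_left h3 (by linarith)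
    have h5 : 5 / π * (1 - t) - ((1 - t) * (3 / π) + 1 / π) = (1 - 2 * t) / π := by field_simp; ring
    have h6 : 0 ≤ (1 - 2 * t) / π := div_nonneg (by linarith) hp.le
    linarith
  · rw [be_cot_refl]
    have hv : 0 < 1 - t := by linarith
    have := be_cot_ge (π * (1 - t)) (by positivity) (by nlinarith)
    have h2 := mul_le_mul_of_nonneg_left this hv.le
    have h3 : (1 - t) * (1 / (π * (1 - t)) - π * (1 - t) / 2) = 1 / π - π / 2 * (1-t)^2 := by
      field_simp
    have h4 : π / 2 * (1-t)^2 ≤ 5 / π * (1 - t) := by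
      have : π / 2 * (1-t) ≤ 5 / π := by
        rw [le_div_iff₀ hp]
        have : π * π ≤ 10 := by nlinarith
        nlinarith
      nlinarith
    linarith

noncomputable def bH (y : ℝ) : ℝ := 2 * ∫ t in Set.Ioo (0:ℝ) 1, beq t * Real.sin (2 * π * t * y)
noncomputable def bK (y : ℝ) : ℝ := 2 * ∫ t in Set.Ioo (0:ℝ) 1, (1 - t) * Real.cos (2 * π * t * y)

theorem be_integrableOn_of_continuous (f : ℝ → ℝ) (hf : Continuous f) (a b : ℝ) :
    IntegrableOn f (Set.Ioo a b) :=
  (hf.integrableOn_Icc (a := a) (b := b)).mono_set Set.Ioo_subset_Icc_self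

theorem be_integrableOn_of_bdd (f : ℝ → ℝ) (hf : Measurable f) (a b C : ℝ)
    (h : ∀ t ∈ Set.Ioo a b, |f t| ≤ C) : IntegrableOn f (Set.Ioo a b) := by
  refine Measure.integrableOn_of_bounded (M := C) (by simp) hf.aestronglyMeasurable ?_
  exact (ae_restrict_mem measurableSet_Ioo).mono (fun t ht => h t ht)

theorem be_measurable_beq : Measurable beq := by
  unfold beq
  fun_prop

theorem be_q_sin_int (c : ℝ) : IntegrableOn (fun t => beq t * Real.sin (t * c)) (Set.Ioo 0 1) := by
  apply be_integrableOn_of_bdd _ (be_measurable_beq.mul (by fun_prop)) 0 1 (|c| / π)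
  intro t ht
  simp only [Pi.mul_apply]
  have hp := Real.pi_pos
  have h0 := ht.1
  rw [abs_mul, abs_of_nonneg (be_q_nonneg t ht.1 ht.2)]
  calc beq t * |Real.sin (t * c)| ≤ 1 / (π * t) * |t * c| := by
        apply mul_le_mul (be_q_le t ht.1 ht.2) Real.abs_sin_le_abs (abs_nonneg _) (by positivity)
    _ = |c| / π := by
        rw [abs_mul, abs_of_pos h0]; field_simp

theorem be_integral_sin (y : ℝ) (hy : y ≠ 0) :
    ∫ t in Set.Ioo (0:ℝ) 1, Real.sin (2 * π * t * y) = Real.sin (π * y) ^ 2 / (π * y) := by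
  have hp := Real.pi_pos
  rw [← integral_Ioc_eq_integral_Ioo, ← intervalIntegral.integral_of_le zero_le_one]
  have : ∀ t ∈ Set.uIcc (0:ℝ) 1, HasDerivAt (fun t => - Real.cos (2 * π * t * y) / (2 * π * y))
      (Real.sin (2 * π * t * y)) t := by
    intro t _
    have h1 : HasDerivAt (fun t : ℝ => 2 * π * t * y) (2 * π * y) t := by
      have := ((hasDerivAt_id t).const_mul (2 * π)).mul_const y
      simpa using this
    refine (h1.cos.neg.div_const (2 * π * y)).congr_deriv ?_
    have : 2 * π * y ≠ 0 := by positivity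
    rw [div_eq_iff this]; ring
  rw [intervalIntegral.integral_eq_sub_of_hasDerivAt this
    (Continuous.intervalIntegrable (by fun_prop) _ _)]
  have h2 : Real.cos (2 * π * 1 * y) = 1 - 2 * Real.sin (π * y) ^ 2 := by
    rw [show 2 * π * 1 * y = 2 * (π * y) by ring, Real.cos_two_mul, Real.cos_sq']
    ring
  rw [h2]
  simp
  field_simp
  ring

theorem bK_eq (y : ℝ) (hy : y ≠ 0) : bK y = Real.sin (π * y) ^ 2 / (π ^ 2 * y ^ 2) := by
  have hp := Real.pi_pos
  unfold bK
  rw [← integral_Ioc_eq_integral_Ioo, ← intervalIntegral.integral_of_le zero_le_one]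
  have : ∀ t ∈ Set.uIcc (0:ℝ) 1, HasDerivAt (fun t => (1 - t) * (Real.sin (2 * π * t * y) / (2 * π * y))
        - Real.cos (2 * π * t * y) / (2 * π * y) ^ 2)
      ((1 - t) * Real.cos (2 * π * t * y)) t := by
    intro t _
    have h1 : HasDerivAt (fun t : ℝ => 2 * π * t * y) (2 * π * y) t := by
      have := ((hasDerivAt_id t).const_mul (2 * π)).mul_const y
      simpa using this
    have h2 : HasDerivAt (fun t : ℝ => 1 - t) (-1) t := by
      simpa using (hasDerivAt_id t).const_sub 1
    refine ((h2.mul (h1.sin.div_const (2 * π * y))).sub (h1.cos.div_const ((2 * π * y)^2))).congr_deriv ?_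
    have : 2 * π * y ≠ 0 := by positivity
    generalize 2 * π * y = c at *
    field_simp
    ring
  rw [intervalIntegral.integral_eq_sub_of_hasDerivAt this
    (Continuous.intervalIntegrable (by fun_prop) _ _)]
  have h2 : Real.cos (2 * π * 1 * y) = 1 - 2 * Real.sin (π * y) ^ 2 := by
    rw [show 2 * π * 1 * y = 2 * (π * y) by ring, Real.cos_two_mul, Real.cos_sq']
    ring
  rw [h2]
  simp
  field_simp
  ring

theorem bK_zero : bK 0 = 1 := by
  unfold bK
  rw [← integral_Ioc_eq_integral_Ioo, ← intervalIntegral.integral_of_le zero_le_one]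
  have : ∫ t in (0:ℝ)..1, (1 - t) * Real.cos (2 * π * t * 0) = ∫ t in (0:ℝ)..1, ((1:ℝ) - t) := by simp
  rw [this, intervalIntegral.integral_sub (by simp) (by simp)]
  simp
  norm_num

theorem bK_nat (n : ℕ) : bK ((n : ℝ) + 1) = 0 := by
  rw [bK_eq _ (by positivity)]
  have : Real.sin (π * ((n:ℝ) + 1)) = 0 := by
    have := Real.sin_nat_mul_pi (n + 1)
    rw [mul_comm]; push_cast at this; exact this
  rw [this]; simp

theorem bK_shift (y : ℝ) (hy : 0 < y) (n : ℕ) :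
    bK (y + ((n:ℝ) + 1)) = Real.sin (π * y) ^ 2 / π ^ 2 * (1 / (y + (n + 1)) ^ 2) := by
  rw [bK_eq _ (by positivity)]
  have : Real.sin (π * (y + ((n:ℝ) + 1))) ^ 2 = Real.sin (π * y) ^ 2 := by
    have := Real.sin_add_nat_mul_pi (π * y) (n + 1)
    have h : π * (y + ((n:ℝ) + 1)) = π * y + ((n + 1 : ℕ) : ℝ) * π := by push_cast; ring
    rw [h, this, mul_pow, ← pow_mul, mul_comm (n+1) 2, pow_mul]; simp
  rw [this]
  have hp := Real.pi_pos
  have : 0 < y + ((n:ℝ) + 1) := by positivity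
  field_simp

theorem be_dirichlet (y t : ℝ) (N : ℕ) :
    Real.sin (π * t) * (Real.cos (2 * π * t * y) +
      2 * ∑ n ∈ range N, Real.cos (2 * π * t * (y + ((n:ℝ) + 1)))) =
    Real.sin (2 * π * t * y + (2 * N + 1) * (π * t)) - Real.sin (2 * π * t * y) * Real.cos (π * t) := by
  induction N with
  | zero => simp [Real.sin_add]; ring
  | succ N ih =>
    rw [Finset.sum_range_succ, mul_add 2, ← add_assoc, mul_add, ih]
    have h1 : 2 * π * t * (y + ((N:ℝ) + 1)) = 2 * π * t * y + (2 * N + 2) * (π * t) := by ring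
    have h2 : 2 * π * t * y + (2 * ((N + 1 : ℕ):ℝ) + 1) * (π * t) =
      (2 * π * t * y + (2 * N + 2) * (π * t)) + π * t := by push_cast; ring
    have h3 : 2 * π * t * y + (2 * (N:ℝ) + 1) * (π * t) =
      (2 * π * t * y + (2 * N + 2) * (π * t)) - π * t := by ring
    rw [h1, h2, h3, Real.sin_add (2 * π * t * y + (2 * N + 2) * (π * t)),
      Real.sin_sub (2 * π * t * y + (2 * N + 2) * (π * t))]
    ring

noncomputable def bw (y t : ℝ) : ℝ := (1 - t) * (Real.sin (π * t * y) / Real.sin (π * t))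

theorem be_pointwise (y t : ℝ) (N : ℕ) (h0 : 0 < t) (h1 : t < 1) :
    (1 - t) * (Real.cos (2 * π * t * y) +
      2 * ∑ n ∈ range N, Real.cos (2 * π * t * (y + ((n:ℝ) + 1)))) =
    (1 - t) * (Real.cos (2 * π * t * 0) +
      2 * ∑ n ∈ range N, Real.cos (2 * π * t * (0 + ((n:ℝ) + 1)))) +
    2 * (bw y t * Real.cos ((2 * N + 1 + y) * π * t)) - beq t * Real.sin (2 * π * t * y) +
    1 / π * Real.sin (2 * π * t * y) := by
  have hp := Real.pi_pos
  have hs : 0 < Real.sin (π * t) := Real.sin_pos_of_pos_of_lt_pi (by positivity) (by nlinarith)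
  have e1 := be_dirichlet y t N
  have e2 := be_dirichlet 0 t N
  rw [mul_comm, ← eq_div_iff hs.ne'] at e1 e2
  rw [e1, e2]
  unfold bw beq
  have h3 : Real.sin (2 * π * t * y + (2 * N + 1) * (π * t)) -
      Real.sin (2 * π * t * 0 + (2 * N + 1) * (π * t)) =
      2 * Real.sin (π * t * y) * Real.cos ((2 * N + 1 + y) * π * t) := by
    rw [Real.sin_sub_sin]
    congr 2 <;> ring_nf
  have h4 : Real.sin (2 * π * t * 0) = 0 := by simp
  rw [h4, ← sub_eq_zero]
  have h5 := sub_eq_iff_eq_add.1 h3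
  rw [h5]
  field_simp
  ring

theorem be_bw_int (y : ℝ) (hy : 0 < y) (c : ℝ) :
    IntegrableOn (fun t => bw y t * Real.cos (c * π * t)) (Set.Ioo 0 1) := by
  apply be_integrableOn_of_bdd _ (by unfold bw; fun_prop) 0 1 y
  intro t ht
  have hp := Real.pi_pos
  obtain ⟨h0, h1⟩ := ht
  have hs : 0 < Real.sin (π * t) := Real.sin_pos_of_pos_of_lt_pi (by positivity) (by nlinarith)
  have h2 := be_sin_lower (π * t) (by positivity) (by nlinarith)
  rw [mul_div_assoc, ] at h2
  rw [abs_mul]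
  have h3 : |bw y t| ≤ y := by
    unfold bw
    rw [abs_mul, abs_div, abs_of_pos hs, abs_of_pos (by linarith : 0 < 1 - t), ← mul_div_assoc,
      div_le_iff₀ hs]
    have h4 : |Real.sin (π * t * y)| ≤ π * t * y := by
      refine Real.abs_sin_le_abs.trans (le_of_eq ?_)
      rw [abs_of_pos (by positivity)]
    have h5 : π * (t / π) = t := by field_simp
    rw [h5] at h2
    calc (1 - t) * |Real.sin (π * t * y)| ≤ (1 - t) * (π * t * y) := by
          apply mul_le_mul_of_nonneg_left h4; linarith
      _ = y * (π * t * (1 - t)) := by ring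
      _ ≤ _ := by gcongr
  calc |bw y t| * |Real.cos (c * π * t)| ≤ y * 1 :=
        mul_le_mul h3 (Real.abs_cos_le_one _) (abs_nonneg _) hy.le
    _ = y := mul_one y

theorem be_RL (w : ℝ → ℝ) (hw : IntegrableOn w (Set.Ioo (0:ℝ) 1)) (y : ℝ) :
    Filter.Tendsto (fun N : ℕ => ∫ t in Set.Ioo (0:ℝ) 1, w t * Real.cos ((2 * N + 1 + y) * π * t))
      Filter.atTop (nhds 0) := by
  have h1 := Real.tendsto_integral_exp_smul_cocompact
    (fun t => ((Set.indicator (Set.Ioo (0:ℝ) 1) w t : ℝ) : ℂ))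
  have h2 : Filter.Tendsto (fun N : ℕ => (2 * (N:ℝ) + 1 + y) / 2) Filter.atTop (Filter.cocompact ℝ) := by
    refine Filter.Tendsto.mono_right ?_ atTop_le_cocompact
    apply Filter.Tendsto.atTop_div_const (by norm_num)
    apply Filter.tendsto_atTop_add_const_right
    apply Filter.tendsto_atTop_add_const_right
    exact Filter.Tendsto.const_mul_atTop (by norm_num) tendsto_natCast_atTop_atTop
  have h3 := (Complex.continuous_re.tendsto 0).comp (h1.comp h2)
  simp only [Complex.zero_re] at h3
  refine h3.congr (fun N => ?_)
  simp only [Function.comp]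
  have hi : Integrable (fun t => ((Set.indicator (Set.Ioo (0:ℝ) 1) w t : ℝ) : ℂ)) := by
    exact ((integrable_indicator_iff measurableSet_Ioo).2 hw).ofReal
  have hi2 := (Real.fourierIntegral_convergent_iff (μ := volume) ((2 * (N:ℝ) + 1 + y) / 2)).2 hi
  have hi3 : Integrable (fun t : ℝ => Real.fourierChar (-(t * ((2 * (N:ℝ) + 1 + y) / 2))) •
      ((Set.indicator (Set.Ioo (0:ℝ) 1) w t : ℝ) : ℂ)) := by
    refine hi2.congr (Filter.Eventually.of_forall (fun t => ?_))
    simp [mul_comm]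
  have h4 := integral_re hi3
  simp only [RCLike.re_to_complex] at h4
  rw [← h4, ← integral_indicator measurableSet_Ioo]
  congr 1
  ext t
  rw [Circle.smul_def, Real.fourierChar_apply, smul_eq_mul, Complex.re_mul_ofReal]
  have h5 : (Complex.exp (↑(2 * π * -(t * ((2 * (N:ℝ) + 1 + y) / 2))) * Complex.I)).re
      = Real.cos ((2 * N + 1 + y) * π * t) := by
    rw [Complex.exp_ofReal_mul_I_re, ← Real.cos_neg]
    congr 1; ring
  rw [h5]
  by_cases ht : t ∈ Set.Ioo (0:ℝ) 1
  · simp [Set.indicator_of_mem ht, mul_comm]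
  · simp [Set.indicator_of_notMem ht]

theorem be_identity (y : ℝ) (hy : 0 < y) (N : ℕ) :
    bK y + 2 * ∑ n ∈ range N, bK (y + ((n:ℝ) + 1)) =
    1 + 4 * (∫ t in Set.Ioo (0:ℝ) 1, bw y t * Real.cos ((2 * N + 1 + y) * π * t)) - bH y
      + 2 * (Real.sin (π * y) ^ 2 / (π ^ 2 * y)) := by
  have hsum : ∀ z : ℝ, bK z + 2 * ∑ n ∈ range N, bK (z + ((n:ℝ) + 1)) =
      2 * ∫ t in Set.Ioo (0:ℝ) 1, (1 - t) * (Real.cos (2 * π * t * z) +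
      2 * ∑ n ∈ range N, Real.cos (2 * π * t * (z + ((n:ℝ) + 1)))) := by
    intro z
    unfold bK
    rw [← Finset.mul_sum, ← integral_finsetSum]
    · rw [← mul_assoc, mul_comm 2 2, mul_assoc, ← mul_add, ← integral_const_mul, ← integral_add]
      · congr 1
        congr 1
        ext t
        rw [mul_add, ← Finset.mul_sum]; ring
      · exact be_integrableOn_of_continuous _ (by fun_prop) _ _
      · exact be_integrableOn_of_continuous _ (by fun_prop) _ _
    · intro i _
      exact be_integrableOn_of_continuous _ (by fun_prop) _ _
  rw [hsum y, setIntegral_congr_fun measurableSet_Ioo (fun t ht => be_pointwise y t N ht.1 ht.2)]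
  have hb := be_bw_int y hy (2 * N + 1 + y)
  have hq : IntegrableOn (fun t => beq t * Real.sin (2 * π * t * y)) (Set.Ioo 0 1) := by
    have := be_q_sin_int (2 * π * y)
    refine this.congr_fun (fun t _ => ?_) measurableSet_Ioo
    simp only
    congr 2; ring
  have h0 : IntegrableOn (fun t : ℝ => (1 - t) * (Real.cos (2 * π * t * 0) +
      2 * ∑ n ∈ range N, Real.cos (2 * π * t * (0 + ((n:ℝ) + 1))))) (Set.Ioo 0 1) :=
    be_integrableOn_of_continuous _ (by fun_prop) _ _
  have hs : IntegrableOn (fun t : ℝ => 1 / π * Real.sin (2 * π * t * y)) (Set.Ioo 0 1) :=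
    be_integrableOn_of_continuous _ (by fun_prop) _ _
  have h01 : IntegrableOn (fun t : ℝ => (1 - t) * (Real.cos (2 * π * t * 0) +
      2 * ∑ n ∈ range N, Real.cos (2 * π * t * (0 + ((n:ℝ) + 1)))) +
      2 * (bw y t * Real.cos ((2 * N + 1 + y) * π * t))) (Set.Ioo 0 1) := h0.add (hb.const_mul 2)
  have h02 : IntegrableOn (fun t : ℝ => (1 - t) * (Real.cos (2 * π * t * 0) +
      2 * ∑ n ∈ range N, Real.cos (2 * π * t * (0 + ((n:ℝ) + 1)))) +
      2 * (bw y t * Real.cos ((2 * N + 1 + y) * π * t)) - beq t * Real.sin (2 * π * t * y))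
      (Set.Ioo 0 1) := h01.sub hq
  rw [integral_add h02 hs, integral_sub h01 hq,
    integral_add h0 (hb.const_mul 2), integral_const_mul, integral_const_mul,
    be_integral_sin y hy.ne']
  have h1 := hsum 0
  have h2 : ∑ n ∈ range N, bK (0 + ((n:ℝ) + 1)) = 0 := by
    apply Finset.sum_eq_zero
    intro n _
    rw [zero_add, bK_nat]
  rw [h2, bK_zero] at h1
  unfold bH
  have hp := Real.pi_pos
  have : 1 / π * (Real.sin (π * y) ^ 2 / (π * y)) = Real.sin (π * y) ^ 2 / (π ^ 2 * y) := by
    field_simp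
  rw [this]
  linarith

theorem be_sum_upper (y : ℝ) (hy : 0 < y) (N : ℕ) :
    ∑ n ∈ range N, 1 / (y + ((n:ℝ) + 1)) ^ 2 ≤ 1 / y - 1 / (y + N) := by
  induction N with
  | zero => simp
  | succ N ih =>
    rw [Finset.sum_range_succ]
    have h1 : 0 < y + N := by positivity
    have : 1 / (y + ((N:ℝ) + 1)) ^ 2 ≤ 1 / (y + N) - 1 / (y + ((N:ℝ) + 1)) := by
      rw [div_sub_div _ _ h1.ne' (by positivity), div_le_div_iff₀ (by positivity) (by positivity)]
      nlinarith
    push_cast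
    linarith

theorem be_sum_lower (y : ℝ) (hy : 0 < y) (N : ℕ) :
    1 / (y + 1) - 1 / (y + (N + 1)) ≤ ∑ n ∈ range N, 1 / (y + ((n:ℝ) + 1)) ^ 2 := by
  induction N with
  | zero => simp
  | succ N ih =>
    rw [Finset.sum_range_succ]
    have h1 : 0 < y + ((N:ℝ) + 1) := by positivity
    have : 1 / (y + ((N:ℝ) + 1)) - 1 / (y + ((N:ℝ) + 1 + 1)) ≤ 1 / (y + ((N:ℝ) + 1)) ^ 2 := by
      rw [div_sub_div _ _ h1.ne' (by positivity), div_le_div_iff₀ (by positivity) (by positivity)]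
      nlinarith
    push_cast
    linarith

theorem be_beurling_pos (y : ℝ) (hy : 0 < y) : |1 - bH y| ≤ bK y := by
  have hp := Real.pi_pos
  have hw : IntegrableOn (bw y) (Set.Ioo (0:ℝ) 1) := by
    have := be_bw_int y hy 0
    simpa using this
  have hlim := be_RL (bw y) hw y
  have hK := bK_eq y hy.ne'
  set s := Real.sin (π * y) ^ 2 / π ^ 2 with hs
  have hs0 : 0 ≤ s := by positivity
  have hK' : bK y = s * (1 / y ^ 2) := by rw [hK, hs]; field_simp
  have hid : ∀ N : ℕ, 1 - bH y + 4 * (∫ t in Set.Ioo (0:ℝ) 1, bw y t * Real.cos ((2 * N + 1 + y) * π * t))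
      = s * (1 / y ^ 2 + 2 * ∑ n ∈ range N, 1 / (y + ((n:ℝ) + 1)) ^ 2 - 2 / y) := by
    intro N
    have h := be_identity y hy N
    rw [Finset.sum_congr rfl (fun n _ => bK_shift y hy n), ← Finset.mul_sum, hK'] at h
    have : Real.sin (π * y) ^ 2 / (π ^ 2 * y) = s * (1 / y) := by rw [hs]; field_simp
    rw [this] at h
    have h2 : 2 / y = 2 * (1 / y) := by ring
    rw [h2]
    linarith
  have hlim2 : Filter.Tendsto (fun N : ℕ => 1 - bH y +
      4 * (∫ t in Set.Ioo (0:ℝ) 1, bw y t * Real.cos ((2 * N + 1 + y) * π * t)))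
      Filter.atTop (nhds (1 - bH y)) := by
    simpa using (hlim.const_mul 4).const_add (1 - bH y)
  rw [abs_le]
  constructor
  · have hl3 : Filter.Tendsto (fun N : ℕ => - bK y - s * 2 * (1 / (y + (N + 1)))) Filter.atTop
        (nhds (- bK y)) := by
      have : Filter.Tendsto (fun N : ℕ => (1 / (y + ((N:ℝ) + 1)))) Filter.atTop (nhds 0) := by
        simp only [one_div]
        apply Filter.Tendsto.inv_tendsto_atTop
        apply Filter.tendsto_atTop_add_const_left
        apply Filter.tendsto_atTop_add_const_right
        exact tendsto_natCast_atTop_atTop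
      simpa using (this.const_mul (s * 2)).const_sub (- bK y)
    refine le_of_tendsto_of_tendsto' hl3 hlim2 (fun N => ?_)
    rw [hid, hK']
    have h1 := be_sum_lower y hy N
    have h2 : 2 / y - 2 / (y + 1) ≤ 2 * (1 / y ^ 2) := by
      rw [div_sub_div _ _ hy.ne' (by positivity), mul_one_div, div_le_div_iff₀ (by positivity) (by positivity)]
      nlinarith [mul_pos hy hy]
    have h3 : -(1 / y ^ 2) - 2 * (1 / (y + (N + 1))) ≤
        (1 / y ^ 2 + 2 * ∑ n ∈ range N, 1 / (y + ((n:ℝ) + 1)) ^ 2 - 2 / y) := by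
      have : 2 / (y + 1) = 2 * (1 / (y + 1)) := by ring
      linarith
    have := mul_le_mul_of_nonneg_left h3 hs0
    linarith
  · refine le_of_tendsto' hlim2 (fun N => ?_)
    rw [hid, hK']
    apply mul_le_mul_of_nonneg_left _ hs0
    have h1 := be_sum_upper y hy N
    have h2 : 0 ≤ 1 / (y + (N:ℝ)) := by positivity
    have : 2 / y = 2 * (1 / y) := by ring
    linarith

theorem bH_neg (y : ℝ) : bH (-y) = - bH y := by
  unfold bH
  rw [← mul_neg, ← integral_neg]
  congr 2
  ext t
  rw [mul_neg, Real.sin_neg]; ring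

theorem bK_neg (y : ℝ) : bK (-y) = bK y := by
  unfold bK
  congr 2
  ext t
  rw [mul_neg, Real.cos_neg]

/-- two-sided Beurling bound for the indicator of the positive half line -/
theorem be_indicator (y : ℝ) :
    |(if 0 < y then (1:ℝ) else 0) - 1 / 2 - 1 / 2 * bH y| ≤ 1 / 2 * bK y := by
  rcases lt_trichotomy y 0 with h | h | h
  · have := be_beurling_pos (-y) (by linarith)
    rw [bH_neg, bK_neg, abs_le] at this
    rw [if_neg (by linarith), abs_le]
    constructor <;> linarith
  · subst h
    have : bH 0 = 0 := by simp [bH]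
    rw [this, bK_zero]
    norm_num
  · have := be_beurling_pos y h
    rw [abs_le] at this
    rw [if_pos h, abs_le]
    constructor <;> linarith

noncomputable def bS {n : ℕ} (b : Fin n → ℝ) (ε : Fin n → Bool) : ℝ := ∑ j, b j * pm (ε j)
noncomputable def bf {n : ℕ} (b : Fin n → ℝ) (s : ℝ) : ℝ := ∏ j, Real.cos (b j * s)

theorem be_cf {n : ℕ} (b : Fin n → ℝ) (s : ℝ) :
    ∑ ε : Fin n → Bool, Complex.exp ((s * bS b ε : ℝ) * Complex.I) = 2 ^ n * ((bf b s : ℝ) : ℂ) := by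
  have h1 : ∀ ε : Fin n → Bool, Complex.exp ((s * bS b ε : ℝ) * Complex.I) =
      ∏ j, Complex.exp ((s * (b j * pm (ε j)) : ℝ) * Complex.I) := by
    intro ε
    rw [← Complex.exp_sum, ← Finset.sum_mul, bS, Finset.mul_sum, Complex.ofReal_sum]
  rw [Finset.sum_congr rfl (fun ε _ => h1 ε)]
  have h2 := Finset.prod_univ_sum (fun _ : Fin n => (Finset.univ : Finset Bool))
    (fun j e => Complex.exp ((s * (b j * pm e) : ℝ) * Complex.I))
  rw [Fintype.piFinset_univ] at h2
  rw [← h2]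
  have h3 : ∀ j : Fin n, ∑ e : Bool, Complex.exp ((s * (b j * pm e) : ℝ) * Complex.I) =
      2 * ((Real.cos (b j * s) : ℝ) : ℂ) := by
    intro j
    rw [Fintype.sum_bool, Complex.ofReal_cos, Complex.two_cos]
    simp only [pm]
    congr 2 <;> push_cast <;> simp <;> ring_nf
  rw [Finset.prod_congr rfl (fun j _ => h3 j), Finset.prod_mul_distrib, bf, Complex.ofReal_prod]
  simp

theorem be_sum_cos {n : ℕ} (b : Fin n → ℝ) (s : ℝ) :
    ∑ ε : Fin n → Bool, Real.cos (s * bS b ε) = 2 ^ n * bf b s := by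
  have h := congrArg Complex.re (be_cf b s)
  rw [Complex.re_sum] at h
  simp only [Complex.exp_ofReal_mul_I_re] at h
  rw [h]
  rw [show (2:ℂ)^n = ((2^n : ℝ) : ℂ) by push_cast; rfl, ← Complex.ofReal_mul, Complex.ofReal_re]

theorem be_sum_sin {n : ℕ} (b : Fin n → ℝ) (s : ℝ) :
    ∑ ε : Fin n → Bool, Real.sin (s * bS b ε) = 0 := by
  have h := congrArg Complex.im (be_cf b s)
  rw [Complex.im_sum] at h
  simp only [Complex.exp_ofReal_mul_I_im] at h
  rw [h]
  rw [show (2:ℂ)^n = ((2^n : ℝ) : ℂ) by push_cast; rfl, ← Complex.ofReal_mul, Complex.ofReal_im]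

theorem be_sum_sin_x {n : ℕ} (b : Fin n → ℝ) (s x : ℝ) :
    ∑ ε : Fin n → Bool, Real.sin (s * (x - bS b ε)) = 2 ^ n * (Real.sin (s * x) * bf b s) := by
  simp only [mul_sub, Real.sin_sub, Finset.sum_sub_distrib, ← Finset.mul_sum, be_sum_sin, be_sum_cos]
  ring

theorem be_sum_cos_x {n : ℕ} (b : Fin n → ℝ) (s x : ℝ) :
    ∑ ε : Fin n → Bool, Real.cos (s * (x - bS b ε)) = 2 ^ n * (Real.cos (s * x) * bf b s) := by
  simp only [mul_sub, Real.cos_sub, Finset.sum_add_distrib, ← Finset.mul_sum, be_sum_sin, be_sum_cos]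
  ring

/-- Prawitz smoothing inequality -/
theorem be_prawitz {n : ℕ} (b : Fin n → ℝ) (T x : ℝ) (hT : 0 < T) :
    |unifPr n (fun ε => bS b ε < x) - 1 / 2 -
      ∫ t in Set.Ioo (0:ℝ) 1, beq t * (Real.sin (T * t * x) * bf b (T * t))| ≤
      ∫ t in Set.Ioo (0:ℝ) 1, (1 - t) * (Real.cos (T * t * x) * bf b (T * t)) := by
  have hp := Real.pi_pos
  set c := T / (2 * π) with hc
  have hc0 : 0 < c := by positivity
  have hcT : ∀ t z : ℝ, 2 * π * t * (c * z) = T * t * z := by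
    intro t z; rw [hc]; field_simp
  have hN : (0:ℝ) < 2 ^ n := by positivity
  have h1 : unifPr n (fun ε => bS b ε < x) =
      (∑ ε : Fin n → Bool, (if 0 < c * (x - bS b ε) then (1:ℝ) else 0)) / 2 ^ n := by
    unfold unifPr
    congr 1
    rw [Finset.card_filter]
    push_cast
    apply Finset.sum_congr rfl
    intro ε _
    have : (0 < c * (x - bS b ε)) ↔ bS b ε < x := by
      rw [mul_pos_iff_of_pos_left hc0, sub_pos]
    simp only [this]
  have hH : ∑ ε : Fin n → Bool, bH (c * (x - bS b ε)) = 2 ^ n * (2 *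
      ∫ t in Set.Ioo (0:ℝ) 1, beq t * (Real.sin (T * t * x) * bf b (T * t))) := by
    unfold bH
    rw [← Finset.mul_sum, ← integral_finsetSum]
    · rw [← mul_assoc, mul_comm (2^n) (2:ℝ), mul_assoc, ← integral_const_mul ((2:ℝ)^n)]
      refine congrArg (fun z => 2 * z) (integral_congr_ae (ae_of_all _ (fun t => ?_)))
      simp only [hcT]
      rw [← Finset.mul_sum, be_sum_sin_x]; ring
    · intro ε _
      have := be_q_sin_int (2 * π * (c * (x - bS b ε)))
      refine this.congr_fun (fun t _ => ?_) measurableSet_Ioo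
      simp only
      congr 2; ring
  have hK : ∑ ε : Fin n → Bool, bK (c * (x - bS b ε)) = 2 ^ n * (2 *
      ∫ t in Set.Ioo (0:ℝ) 1, (1 - t) * (Real.cos (T * t * x) * bf b (T * t))) := by
    unfold bK
    rw [← Finset.mul_sum, ← integral_finsetSum]
    · rw [← mul_assoc, mul_comm (2^n) (2:ℝ), mul_assoc, ← integral_const_mul ((2:ℝ)^n)]
      refine congrArg (fun z => 2 * z) (integral_congr_ae (ae_of_all _ (fun t => ?_)))
      simp only [hcT]
      rw [← Finset.mul_sum, be_sum_cos_x]; ring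
    · intro ε _
      exact be_integrableOn_of_continuous _ (by fun_prop) _ _
  set J := ∫ t in Set.Ioo (0:ℝ) 1, beq t * (Real.sin (T * t * x) * bf b (T * t))
  set W := ∫ t in Set.Ioo (0:ℝ) 1, (1 - t) * (Real.cos (T * t * x) * bf b (T * t))
  have h2 : unifPr n (fun ε => bS b ε < x) - 1 / 2 - J =
      (∑ ε : Fin n → Bool, ((if 0 < c * (x - bS b ε) then (1:ℝ) else 0) - 1 / 2
        - 1 / 2 * bH (c * (x - bS b ε)))) / 2 ^ n := by
    rw [Finset.sum_sub_distrib, Finset.sum_sub_distrib, ← Finset.mul_sum, hH, h1]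
    simp
    field_simp
  rw [h2, abs_div, abs_of_pos hN, div_le_iff₀ hN]
  refine (Finset.abs_sum_le_sum_abs _ _).trans ?_
  refine (Finset.sum_le_sum (fun ε _ => be_indicator _)).trans (le_of_eq ?_)
  rw [← Finset.mul_sum, hK]; ring

theorem be_abs_cos_le (x : ℝ) : |Real.cos x| ≤ Real.exp (-(Real.sin x ^ 2) / 2) := by
  have h1 : Real.cos x ^ 2 ≤ Real.exp (-(Real.sin x ^ 2) / 2) ^ 2 := by
    rw [← Real.exp_nat_mul, Real.cos_sq']
    have := Real.add_one_le_exp (-(Real.sin x ^ 2))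
    have h2 : ((2:ℕ):ℝ) * (-(Real.sin x ^ 2) / 2) = -(Real.sin x ^ 2) := by push_cast; ring
    rw [h2]; linarith
  exact abs_le_of_sq_le_sq h1 (Real.exp_pos _).le |> fun h => h

theorem be_exp_le_sin (x : ℝ) : Real.exp (-(x ^ 2) / 2) ≤ Real.exp (-(Real.sin x ^ 2) / 2) := by
  apply Real.exp_le_exp.2
  have : Real.sin x ^ 2 ≤ x ^ 2 := by
    rw [← sq_abs, ← sq_abs x]
    exact pow_le_pow_left₀ (abs_nonneg _) Real.abs_sin_le_abs 2
  linarith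

theorem be_diff (x : ℝ) : |Real.cos x - Real.exp (-(x ^ 2) / 2)| ≤ x ^ 4 / 8 := by
  have h1 : 1 - x ^ 2 / 2 ≤ Real.cos x := Real.one_sub_sq_div_two_le_cos
  have h2 : 1 - x ^ 2 / 2 ≤ Real.exp (-(x ^ 2) / 2) := by
    have := Real.add_one_le_exp (-(x ^ 2) / 2); linarith
  have h3 : Real.exp (-(x ^ 2) / 2) ≤ 1 - x ^ 2 / 2 + x ^ 4 / 8 := by
    have h := Real.quadratic_le_exp_of_nonneg (x := x ^ 2 / 2) (by positivity)
    rw [neg_div, Real.exp_neg, inv_le_iff_one_le_mul₀ (Real.exp_pos _)]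
    have h0 : 0 ≤ 1 - x ^ 2 / 2 + x ^ 4 / 8 := by nlinarith [sq_nonneg (x^2/2 - 1)]
    have := mul_le_mul_of_nonneg_left h h0
    refine le_trans ?_ this
    nlinarith [sq_nonneg (x^4)]
  have h4 : Real.cos x ≤ 1 - x ^ 2 / 2 + x ^ 4 / 8 := by
    by_cases hx : x ^ 2 ≤ 4
    · have key : ∀ z : ℝ, 0 ≤ z → z ^ 2 ≤ 4 → Real.cos z ≤ 1 - z ^ 2 / 2 + z ^ 4 / 8 := by
        intro z hz hz2
        have hs := Real.sin_ge_sub_cube (x := z / 2) (by linarith)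
        have hc : Real.cos z = 1 - 2 * Real.sin (z / 2) ^ 2 := by
          have := Real.cos_two_mul (z / 2)
          rw [Real.cos_sq'] at this
          rw [show z = 2 * (z / 2) by ring]; rw [this]; ring_nf
        have h5 : 0 ≤ z / 2 - (z / 2) ^ 3 / 6 := by nlinarith
        have h6 := pow_le_pow_left₀ h5 hs 2
        rw [hc]
        have h7 : (z / 2 - (z / 2) ^ 3 / 6) ^ 2 = z^2/4 - z^4/48 + (z^3/48)^2 := by ring
        nlinarith [sq_nonneg (z^3/48), sq_nonneg (z^2)]
      have := key |x| (abs_nonneg x) (by rwa [sq_abs])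
      have h8 : |x| ^ 4 = x ^ 4 := by
        rw [show (4:ℕ) = 2 * 2 by norm_num, pow_mul, sq_abs, pow_mul]
      rwa [Real.cos_abs, sq_abs, h8] at this
    · have := Real.cos_le_one x
      nlinarith
  rw [abs_le]; constructor <;> linarith

/-- tangent-line lower bound for `sin²` -/
theorem be_sin_sq_lower (x p : ℝ) (hp : 0 ≤ p) :
    x ^ 2 * (2 * p * (1 - |x| / π) - p ^ 2) ≤ Real.sin x ^ 2 := by
  have h : ∀ x : ℝ, 0 ≤ x → x ^ 2 * (2 * p * (1 - x / π) - p ^ 2) ≤ Real.sin x ^ 2 := by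
    intro x hx
    have hpi := Real.pi_pos
    rcases le_total x π with h1 | h1
    · have h2 := be_sin_lower x hx h1
      have h3 : 0 ≤ 1 - x / π := by
        rw [sub_nonneg, div_le_one hpi]; exact h1
      have h4 := pow_le_pow_left₀ (mul_nonneg hx h3) h2 2
      refine le_trans ?_ h4
      rw [mul_pow]
      apply mul_le_mul_of_nonneg_left _ (sq_nonneg x)
      nlinarith [sq_nonneg (1 - x / π - p)]
    · have h3 : 1 - x / π ≤ 0 := by
        rw [sub_nonpos, le_div_iff₀ hpi]; linarith
      have h5 : 2 * p * (1 - x / π) - p ^ 2 ≤ 0 := by nlinarith [mul_nonneg hp (neg_nonneg.2 h3)]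
      nlinarith [mul_nonneg (sq_nonneg x) (neg_nonneg.2 h5), sq_nonneg (Real.sin x)]
  rcases le_total 0 x with h0 | h0
  · rw [abs_of_nonneg h0]; exact h x h0
  · rw [abs_of_nonpos h0]
    have := h (-x) (by linarith)
    simpa using this

theorem be_sum_sin_sq {n : ℕ} (b : Fin n → ℝ) (ℓ s : ℝ) (h2 : ∑ j, b j ^ 2 = 1)
    (h3 : ∑ j, |b j| ^ 3 = ℓ) (hs : 0 ≤ s) (hs1 : s * ℓ ≤ π) :
    s ^ 2 * (1 - s * ℓ / π) ^ 2 ≤ ∑ j, Real.sin (b j * s) ^ 2 := by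
  have hpi := Real.pi_pos
  set p := 1 - s * ℓ / π with hp
  have hp0 : 0 ≤ p := by
    rw [hp, sub_nonneg, div_le_one hpi]; exact hs1
  calc s ^ 2 * p ^ 2 = ∑ j, (b j * s) ^ 2 * (2 * p * (1 - |b j * s| / π) - p ^ 2) := by
        have : ∀ j, (b j * s) ^ 2 * (2 * p * (1 - |b j * s| / π) - p ^ 2) =
            (s ^ 2 * (2 * p - p ^ 2)) * b j ^ 2 - (2 * p * s ^ 3 / π) * |b j| ^ 3 := by
          intro j
          rw [abs_mul, abs_of_nonneg hs]
          have : b j ^ 2 = |b j| ^ 2 := (sq_abs _).symm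
          rw [mul_pow, this]
          ring
        rw [Finset.sum_congr rfl (fun j _ => this j), Finset.sum_sub_distrib, ← Finset.mul_sum,
          ← Finset.mul_sum, h2, h3, hp]
        ring
    _ ≤ _ := Finset.sum_le_sum (fun j _ => be_sin_sq_lower _ p hp0)

theorem be_f_bound {n : ℕ} (b : Fin n → ℝ) (ℓ s : ℝ) (h2 : ∑ j, b j ^ 2 = 1)
    (h3 : ∑ j, |b j| ^ 3 = ℓ) (hs : 0 ≤ s) (hs1 : s * ℓ ≤ π) :
    |bf b s| ≤ Real.exp (-(s ^ 2 * (1 - s * ℓ / π) ^ 2) / 2) := by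
  unfold bf
  rw [Finset.abs_prod]
  refine (Finset.prod_le_prod (fun _ _ => abs_nonneg _) (fun j _ => be_abs_cos_le _)).trans ?_
  rw [← Real.exp_sum]
  apply Real.exp_le_exp.2
  rw [← Finset.sum_div, Finset.sum_neg_distrib]
  have := be_sum_sin_sq b ℓ s h2 h3 hs hs1
  linarith

theorem be_telescope {ι : Type*} [DecidableEq ι] (s : Finset ι) (A B M : ι → ℝ) (hA : ∀ i, |A i| ≤ M i)
    (hB : ∀ i, |B i| ≤ M i) :
    |∏ i ∈ s, A i - ∏ i ∈ s, B i| ≤ ∑ j ∈ s, |A j - B j| * ∏ i ∈ s.erase j, M i := by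
  have hM : ∀ i, 0 ≤ M i := fun i => (abs_nonneg _).trans (hA i)
  induction s using Finset.induction_on with
  | empty => simp
  | insert a s ha ih =>
    rw [Finset.prod_insert ha, Finset.prod_insert ha, Finset.sum_insert ha, Finset.erase_insert ha]
    have e : A a * ∏ i ∈ s, A i - B a * ∏ i ∈ s, B i =
        (A a - B a) * ∏ i ∈ s, A i + B a * (∏ i ∈ s, A i - ∏ i ∈ s, B i) := by ring
    rw [e]
    refine (abs_add_le _ _).trans ?_
    rw [abs_mul, abs_mul]
    have h1 : |∏ i ∈ s, A i| ≤ ∏ i ∈ s, M i := by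
      rw [Finset.abs_prod]
      exact Finset.prod_le_prod (fun _ _ => abs_nonneg _) (fun i _ => hA i)
    have h2 : ∑ j ∈ s, |A j - B j| * ∏ i ∈ (insert a s).erase j, M i =
        M a * ∑ j ∈ s, |A j - B j| * ∏ i ∈ s.erase j, M i := by
      rw [Finset.mul_sum]
      apply Finset.sum_congr rfl
      intro j hj
      have : j ≠ a := fun h => ha (h ▸ hj)
      rw [Finset.erase_insert_of_ne this.symm, Finset.prod_insert (by simp [ha])]
      ring
    rw [h2]
    apply add_le_add
    · exact mul_le_mul_of_nonneg_left h1 (abs_nonneg _)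
    · exact mul_le_mul (hB a) ih (abs_nonneg _) (hM a)

theorem be_fg_bound {n : ℕ} (b : Fin n → ℝ) (ℓ s : ℝ) (h2 : ∑ j, b j ^ 2 = 1)
    (h3 : ∑ j, |b j| ^ 3 = ℓ) (hs : 0 ≤ s) (hs1 : s * ℓ ≤ π) :
    |bf b s - Real.exp (-(s ^ 2) / 2)| ≤ (∑ j, b j ^ 4) * s ^ 4 / 8 *
      (Real.exp (1 / 2) * Real.exp (-(s ^ 2 * (1 - s * ℓ / π) ^ 2) / 2)) := by
  have hg : Real.exp (-(s ^ 2) / 2) = ∏ j, Real.exp (-((b j * s) ^ 2) / 2) := by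
    rw [← Real.exp_sum, ← Finset.sum_div, Finset.sum_neg_distrib]
    simp only [mul_pow]
    rw [← Finset.sum_mul, h2, one_mul]
  rw [hg]
  unfold bf
  refine (be_telescope Finset.univ _ _ (fun j => Real.exp (-(Real.sin (b j * s) ^ 2) / 2))
    (fun j => be_abs_cos_le _) (fun j => ?_)).trans ?_
  · rw [abs_of_pos (Real.exp_pos _)]; exact be_exp_le_sin _
  · rw [Finset.sum_mul, Finset.sum_div, Finset.sum_mul]
    apply Finset.sum_le_sum
    intro j _
    apply mul_le_mul
    · refine (be_diff _).trans (le_of_eq ?_)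
      rw [mul_pow]
    · rw [← Real.exp_sum, ← Real.exp_add]
      apply Real.exp_le_exp.2
      rw [← Finset.sum_div, Finset.sum_neg_distrib]
      have h4 := be_sum_sin_sq b ℓ s h2 h3 hs hs1
      have h5 := Finset.add_sum_erase Finset.univ (fun j => Real.sin (b j * s) ^ 2) (Finset.mem_univ j)
      have h6 := Real.sin_sq_le_one (b j * s)
      linarith
    · positivity
    · positivity

theorem be_fourth {n : ℕ} (b : Fin n → ℝ) (ℓ : ℝ) (h3 : ∑ j, |b j| ^ 3 = ℓ) (hl : 0 < ℓ) :
    ∑ j, b j ^ 4 ≤ ℓ ^ ((4:ℝ) / 3) := by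
  have h1 : ∀ j, |b j| ≤ ℓ ^ ((1:ℝ)/3) := by
    intro j
    have : |b j| ^ 3 ≤ ℓ := by
      rw [← h3]
      exact Finset.single_le_sum (f := fun j => |b j| ^ 3) (fun i _ => by positivity) (Finset.mem_univ j)
    have h := Real.rpow_le_rpow (by positivity) this (by norm_num : (0:ℝ) ≤ 1/3)
    rwa [← Real.rpow_natCast, ← Real.rpow_mul (abs_nonneg _), show ((3:ℕ):ℝ) * (1/3) = 1 by norm_num,
      Real.rpow_one] at h
  calc ∑ j, b j ^ 4 ≤ ∑ j, ℓ ^ ((1:ℝ)/3) * |b j| ^ 3 := by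
        apply Finset.sum_le_sum
        intro j _
        have h8 : b j ^ 4 = |b j| * |b j| ^ 3 := by
          rw [← pow_succ', show (3 + 1:ℕ) = 2 * 2 by norm_num, pow_mul |b j|, sq_abs, ← pow_mul]
        rw [h8]
        exact mul_le_mul_of_nonneg_right (h1 j) (by positivity)
    _ = ℓ ^ ((1:ℝ)/3) * ℓ := by rw [← Finset.mul_sum, h3]
    _ = ℓ ^ ((4:ℝ) / 3) := by
        nth_rewrite 2 [← Real.rpow_one ℓ]
        rw [← Real.rpow_add hl]; norm_num

theorem be_gauss_cos (y : ℝ) :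
    ∫ s in Set.Ioi (0:ℝ), Real.cos (s * y) * Real.exp (-(s ^ 2) / 2) =
      √(2 * π) / 2 * Real.exp (-(y ^ 2) / 2) := by
  have h1 := congrArg Complex.re (fourierIntegral_gaussian (b := (1/2 : ℂ)) (by norm_num) (y : ℂ))
  have hi : Integrable (fun x : ℝ => Complex.exp (Complex.I * y * x) * Complex.exp (-(1/2 : ℂ) * x ^ 2)) := by
    have := integrable_cexp_quadratic (b := (1/2 : ℂ)) (by norm_num) (Complex.I * y) 0
    refine this.congr (ae_of_all _ (fun x => ?_))
    simp only
    rw [← Complex.exp_add]; congr 1; ring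
  have h2 := integral_re hi
  simp only [RCLike.re_to_complex] at h2
  rw [← h2] at h1
  have h3 : ∀ x : ℝ, (Complex.exp (Complex.I * y * x) * Complex.exp (-(1/2 : ℂ) * x ^ 2)).re =
      Real.cos (|x| * y) * Real.exp (-(|x| ^ 2) / 2) := by
    intro x
    have e1 : Complex.I * y * x = ((x * y : ℝ) : ℂ) * Complex.I := by push_cast; ring
    have e2 : (-(1/2 : ℂ) * x ^ 2) = ((-(x ^ 2) / 2 : ℝ) : ℂ) := by push_cast; ring
    rw [e1, e2, ← Complex.ofReal_exp, Complex.re_mul_ofReal, Complex.exp_ofReal_mul_I_re, sq_abs]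
    congr 1
    rcases abs_choice x with h | h <;> rw [h]
    rw [neg_mul, Real.cos_neg]
  simp only [h3] at h1
  rw [integral_comp_abs (f := fun x => Real.cos (x * y) * Real.exp (-(x ^ 2) / 2))] at h1
  have h4 : ((π / (1 / 2) : ℂ) ^ (1 / 2 : ℂ) * Complex.exp (-(y:ℂ) ^ 2 / (4 * (1 / 2)))) =
      ((√(2 * π) * Real.exp (-(y ^ 2) / 2) : ℝ) : ℂ) := by
    have e1 : (π / (1 / 2) : ℂ) = ((2 * π : ℝ) : ℂ) := by push_cast; ring
    have e2 : (1 / 2 : ℂ) = ((1 / 2 : ℝ) : ℂ) := by push_cast; ring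
    rw [e1, Real.sqrt_eq_rpow, Complex.ofReal_mul ((2 * π) ^ (1 / 2 : ℝ)),
      Complex.ofReal_cpow (by positivity : 0 ≤ 2 * π),
      Complex.ofReal_exp]
    push_cast
    congr 2
    ring
  rw [h4, Complex.ofReal_re] at h1
  linarith

theorem be_gauss_int {b : ℝ} (hb : 0 < b) : Integrable (fun s : ℝ => Real.exp (-(b * s ^ 2) / 2)) := by
  refine (integrable_exp_neg_mul_sq (b := b / 2) (by positivity)).congr (ae_of_all _ (fun s => ?_))
  simp only
  congr 1; ring

theorem be_gauss_int1 : Integrable (fun s : ℝ => Real.exp (-(s ^ 2) / 2)) := by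
  simpa using be_gauss_int one_pos

theorem be_gauss_sin_int (x T : ℝ) (hT : 0 < T) : IntegrableOn
    (fun s : ℝ => Real.sin (T * s * x) / (π * s) * Real.exp (-((T * s) ^ 2) / 2)) (Set.Ioi 0) := by
  have hp := Real.pi_pos
  have hg : Integrable (fun s : ℝ => T * |x| / π * Real.exp (-(T ^ 2 * s ^ 2) / 2)) :=
    (be_gauss_int (by positivity)).const_mul _
  refine (hg.integrableOn (s := Set.Ioi 0)).mono' ?_ ?_
  · exact Measurable.aestronglyMeasurable (by fun_prop)
  · refine (ae_restrict_mem measurableSet_Ioi).mono (fun s hs => ?_)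
    have hs : 0 < s := hs
    rw [Real.norm_eq_abs, abs_mul, abs_of_pos (Real.exp_pos _), mul_pow]
    apply mul_le_mul_of_nonneg_right _ (Real.exp_pos _).le
    rw [abs_div, abs_of_pos (by positivity : 0 < π * s), div_le_div_iff₀ (by positivity) hp]
    have := @Real.abs_sin_le_abs (T * s * x)
    rw [abs_mul, abs_of_pos (by positivity : 0 < T * s)] at this
    nlinarith

theorem be_gauss_deriv (x : ℝ) : HasDerivAt
    (fun x : ℝ => ∫ s in Set.Ioi (0:ℝ), Real.sin (s * x) / (π * s) * Real.exp (-(s ^ 2) / 2))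
    (1 / √(2 * π) * Real.exp (-x ^ 2 / 2)) x := by
  have hp := Real.pi_pos
  have h := hasDerivAt_integral_of_dominated_loc_of_deriv_le (μ := volume.restrict (Set.Ioi (0:ℝ)))
    (F := fun x s => Real.sin (s * x) / (π * s) * Real.exp (-(s ^ 2) / 2))
    (F' := fun x s => 1 / π * (Real.cos (s * x) * Real.exp (-(s ^ 2) / 2)))
    (bound := fun s => 1 / π * Real.exp (-(s ^ 2) / 2)) (x₀ := x) (s := Set.univ) Filter.univ_mem
    (Filter.Eventually.of_forall (fun x => Measurable.aestronglyMeasurable (by fun_prop)))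
    (by
      have := be_gauss_sin_int x 1 one_pos
      simp only [one_mul] at this
      exact this)
    (Measurable.aestronglyMeasurable (by fun_prop))
    (ae_of_all _ (fun s z _ => by
      rw [Real.norm_eq_abs, abs_mul, abs_mul, abs_of_pos (Real.exp_pos _), abs_of_pos (by positivity)]
      apply mul_le_mul_of_nonneg_left _ (by positivity)
      have := Real.abs_cos_le_one (s * z)
      nlinarith [Real.exp_pos (-(s ^ 2) / 2)]))
    ((be_gauss_int1.const_mul _).integrableOn)
    ((ae_restrict_mem measurableSet_Ioi).mono (fun s hs z _ => by
      have hs : 0 < s := hs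
      have h1 : HasDerivAt (fun z : ℝ => s * z) s z := by
        simpa using (hasDerivAt_id z).const_mul s
      refine ((h1.sin.div_const (π * s)).mul_const (Real.exp (-(s ^ 2) / 2))).congr_deriv ?_
      field_simp))
  have h2 := h.2
  rw [integral_const_mul, be_gauss_cos] at h2
  refine h2.congr_deriv ?_
  have h3 : √(2 * π) * √(2 * π) = 2 * π := Real.mul_self_sqrt (by positivity)
  have h4 : 0 < √(2 * π) := by positivity
  rw [← mul_assoc]
  congr 1
  rw [eq_div_iff h4.ne']
  have h5 : 1 / π * (√(2 * π) / 2) * √(2 * π) = (√(2 * π) * √(2 * π)) / (2 * π) := by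
    field_simp
  rw [h5, h3]
  field_simp

theorem be_gauss_inv (x : ℝ) (Φ : ℝ → ℝ)
    (hΦ : ∀ x : ℝ, Φ x = (1 / Real.sqrt (2 * Real.pi)) * ∫ t in Set.Iio x, Real.exp (-t ^ 2 / 2)) :
    Φ x - 1 / 2 = ∫ s in Set.Ioi (0:ℝ), Real.sin (s * x) / (π * s) * Real.exp (-(s ^ 2) / 2) := by
  have h1 := intervalIntegral.integral_eq_sub_of_hasDerivAt (a := 0) (b := x)
    (fun z _ => be_gauss_deriv z) (Continuous.intervalIntegrable (by fun_prop) _ _)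
  simp only [mul_zero, Real.sin_zero, zero_div, zero_mul, integral_zero, sub_zero] at h1
  rw [← h1, intervalIntegral.integral_const_mul, hΦ x]
  have hi := be_gauss_int1
  rw [← integral_Iic_eq_integral_Iio]
  have h2 := intervalIntegral.integral_Iic_sub_Iic (a := 0) (b := x) hi.integrableOn hi.integrableOn
  rw [← h2]
  have h3 : ∫ t in Set.Iic (0:ℝ), Real.exp (-t ^ 2 / 2) = √(2 * π) / 2 := by
    have := integral_comp_neg_Iic (0:ℝ) (fun t => Real.exp (-t ^ 2 / 2))
    simp only [neg_zero, even_two, Even.neg_pow] at this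
    rw [this]
    have h := be_gauss_cos 0
    simpa using h
  have h4 : 0 < √(2 * π) := by positivity
  rw [h3]
  field_simp

theorem be_gauss_inv_T (x T : ℝ) (hT : 0 < T) (Φ : ℝ → ℝ)
    (hΦ : ∀ x : ℝ, Φ x = (1 / Real.sqrt (2 * Real.pi)) * ∫ t in Set.Iio x, Real.exp (-t ^ 2 / 2)) :
    Φ x - 1 / 2 = ∫ t in Set.Ioi (0:ℝ),
      Real.sin (T * t * x) / (π * t) * Real.exp (-((T * t) ^ 2) / 2) := by
  rw [be_gauss_inv x Φ hΦ]
  have h := integral_comp_mul_left_Ioi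
    (fun s => Real.sin (s * x) / (π * s) * Real.exp (-(s ^ 2) / 2)) 0 hT
  rw [mul_zero, smul_eq_mul, eq_inv_mul_iff_mul_eq₀ hT.ne', ← integral_const_mul] at h
  rw [← h]
  congr 1
  ext t
  rw [← mul_assoc]
  congr 1
  by_cases ht : t = 0
  · simp [ht]
  · have hp := Real.pi_pos
    field_simp

theorem be_setIntegral_abs_le (S : Set ℝ) (hS : MeasurableSet S) (u v : ℝ → ℝ) (hv : IntegrableOn v S)
    (h : ∀ t ∈ S, |u t| ≤ v t) : |∫ t in S, u t| ≤ ∫ t in S, v t := by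
  have := norm_integral_le_of_norm_le (μ := volume.restrict S) (f := u) hv
    ((ae_restrict_mem hS).mono (fun t ht => by simpa using h t ht))
  simpa using this

theorem be_setIntegral_le_Ioi (S : Set ℝ) (hS : S ⊆ Set.Ioi 0) (v : ℝ → ℝ)
    (hv : IntegrableOn v (Set.Ioi 0)) (h : ∀ t, 0 < t → 0 ≤ v t) :
    ∫ t in S, v t ≤ ∫ t in Set.Ioi (0:ℝ), v t := by
  apply setIntegral_mono_set hv
  · exact (ae_restrict_mem measurableSet_Ioi).mono (fun t ht => h t ht)
  · exact Filter.Eventually.of_forall hS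

theorem be_int_t {b : ℝ} (hb : 0 < b) :
    IntegrableOn (fun t : ℝ => t * Real.exp (-b * t ^ 2)) (Set.Ioi 0) ∧
    ∫ t in Set.Ioi (0:ℝ), t * Real.exp (-b * t ^ 2) = 1 / (2 * b) := by
  constructor
  · exact (integrable_mul_exp_neg_mul_sq hb).integrableOn
  · have h := integral_rpow_mul_exp_neg_mul_rpow (p := 2) (q := 1) (b := b) (by norm_num) (by norm_num) hb
    simp only [Real.rpow_one, Real.rpow_two] at h
    rw [h]
    norm_num
    rw [Real.rpow_neg_one]

theorem be_int_t3 {b : ℝ} (hb : 0 < b) :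
    IntegrableOn (fun t : ℝ => t ^ 3 * Real.exp (-b * t ^ 2)) (Set.Ioi 0) ∧
    ∫ t in Set.Ioi (0:ℝ), t ^ 3 * Real.exp (-b * t ^ 2) = 1 / (2 * b ^ 2) := by
  constructor
  · have := (integrable_rpow_mul_exp_neg_mul_sq (s := 3) hb (by norm_num)).integrableOn (s := Set.Ioi 0)
    refine this.congr_fun (fun t _ => ?_) measurableSet_Ioi
    simp only
    rw [show (3:ℝ) = ((3:ℕ):ℝ) by norm_num, Real.rpow_natCast]
  · have h := integral_rpow_mul_exp_neg_mul_rpow (p := 2) (q := 3) (b := b) (by norm_num) (by norm_num) hb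
    have e3 : ∀ t : ℝ, t ^ (3:ℝ) = t ^ 3 := fun t => by
      rw [show (3:ℝ) = ((3:ℕ):ℝ) by norm_num, Real.rpow_natCast]
    simp only [e3, Real.rpow_two] at h
    rw [h]
    have : (-(3 + 1) / 2 : ℝ) = -((2:ℕ):ℝ) := by norm_num
    rw [this, Real.rpow_neg hb.le, Real.rpow_natCast]
    have : ((3 + 1) / 2 : ℝ) = 2 := by norm_num
    rw [this, Real.Gamma_two]
    field_simp

theorem be_int_right (T : ℝ) (hT : 0 < T) :
    IntegrableOn (fun t : ℝ => (1 - t) * Real.exp (-(T ^ 2 * (1 - t) ^ 2) / 18)) (Set.Ioo (1/3) 1) ∧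
    ∫ t in Set.Ioo (1/3 : ℝ) 1, (1 - t) * Real.exp (-(T ^ 2 * (1 - t) ^ 2) / 18) ≤ 9 / T ^ 2 := by
  constructor
  · exact be_integrableOn_of_continuous _ (by fun_prop) _ _
  · rw [← integral_Ioc_eq_integral_Ioo, ← intervalIntegral.integral_of_le (by norm_num)]
    have : ∀ t ∈ Set.uIcc (1/3 : ℝ) 1, HasDerivAt
        (fun t => 9 / T ^ 2 * Real.exp (-(T ^ 2 * (1 - t) ^ 2) / 18))
        ((1 - t) * Real.exp (-(T ^ 2 * (1 - t) ^ 2) / 18)) t := by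
      intro t _
      have h2 : HasDerivAt (fun t : ℝ => 1 - t) (-1) t := by
        simpa using (hasDerivAt_id t).const_sub 1
      refine ((((h2.pow 2).const_mul (T ^ 2)).neg.div_const 18).exp.const_mul (9 / T ^ 2)).congr_deriv ?_
      simp
      field_simp
      ring
    rw [intervalIntegral.integral_eq_sub_of_hasDerivAt this
      (Continuous.intervalIntegrable (by fun_prop) _ _)]
    have h1 : 0 ≤ 9 / T ^ 2 * Real.exp (-(T ^ 2 * (1 - 1/3 : ℝ) ^ 2) / 18) := by positivity
    simp at h1 ⊢
    linarith

set_option maxHeartbeats 4000000 in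
theorem be_main {n : ℕ} (b : Fin n → ℝ) (ℓ x : ℝ) (h2 : ∑ j, b j ^ 2 = 1)
    (h3 : ∑ j, |b j| ^ 3 = ℓ) (hl : 0 < ℓ) (Φ : ℝ → ℝ)
    (hΦ : ∀ x : ℝ, Φ x = (1 / Real.sqrt (2 * Real.pi)) * ∫ t in Set.Iio x, Real.exp (-t ^ 2 / 2)) :
    |unifPr n (fun ε => bS b ε < x) - Φ x| ≤ ℓ / √(2 * π) +
      ℓ ^ ((4:ℝ)/3) * (Real.exp (1/2) / 8 * (81 / 8) * (1 / 3 + 1 / π)) +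
      ℓ ^ 2 * ((9 + 54 / π + π / 2) / π ^ 2) := by
  have hp := Real.pi_pos
  set T := π / ℓ with hTdef
  have hT : 0 < T := by positivity
  have hTl : T * ℓ = π := by rw [hTdef]; field_simp
  set L := ℓ ^ ((4:ℝ)/3) with hL
  have hL0 : 0 < L := by positivity
  set g : ℝ → ℝ := fun t => Real.exp (-((T * t) ^ 2) / 2) with hg
  set f : ℝ → ℝ := fun t => bf b (T * t) with hf
  set C := L * Real.exp (1/2) / 8 * T ^ 4 with hC
  set D : ℝ → ℝ := fun t => C * (t ^ 3 * Real.exp (-(2 / 9 * T ^ 2) * t ^ 2)) with hD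
  set E : ℝ → ℝ := fun t => (1 - t) * Real.exp (-(T ^ 2 * (1 - t) ^ 2) / 18) with hE
  have hC0 : 0 < C := by positivity
  have hfc : Continuous f := by
    rw [hf]; unfold bf; fun_prop
  have hg0 : ∀ t, 0 < g t := fun t => Real.exp_pos _
  -- pointwise bounds
  have hfg : ∀ t, 0 < t → t ≤ 1 / 3 → |f t - g t| ≤ t * D t := by
    intro t h0 h1
    have hs1 : T * t * ℓ = π * t := by rw [← hTl]; ring
    have h := be_fg_bound b ℓ (T * t) h2 h3 (by positivity) (by rw [hs1]; nlinarith)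
    have h4 := be_fourth b ℓ h3 hl
    have e1 : 1 - T * t * ℓ / π = 1 - t := by rw [hs1]; field_simp
    rw [e1] at h
    refine h.trans ?_
    have h5 : Real.exp (-((T * t) ^ 2 * (1 - t) ^ 2) / 2) ≤ Real.exp (-(2 / 9 * T ^ 2) * t ^ 2) := by
      apply Real.exp_le_exp.2
      have : (4:ℝ)/9 ≤ (1 - t) ^ 2 := by nlinarith
      have := mul_le_mul_of_nonneg_left this (sq_nonneg (T * t))
      nlinarith
    calc (∑ j, b j ^ 4) * (T * t) ^ 4 / 8 * (Real.exp (1 / 2) * Real.exp (-((T * t) ^ 2 * (1 - t) ^ 2) / 2))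
        ≤ L * (T * t) ^ 4 / 8 * (Real.exp (1 / 2) * Real.exp (-(2 / 9 * T ^ 2) * t ^ 2)) := by
          gcongr
      _ = t * D t := by
          simp only [hD, hC]; ring
  have hfB : ∀ t, 1 / 3 ≤ t → t < 1 → (1 - t) * |f t| ≤ E t := by
    intro t h0 h1
    have ht : 0 < t := by linarith
    have hs1 : T * t * ℓ = π * t := by rw [← hTl]; ring
    have h := be_f_bound b ℓ (T * t) h2 h3 (by positivity) (by rw [hs1]; nlinarith)
    have e1 : 1 - T * t * ℓ / π = 1 - t := by rw [hs1]; field_simp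
    rw [e1] at h
    apply mul_le_mul_of_nonneg_left _ (by linarith)
    refine h.trans (Real.exp_le_exp.2 ?_)
    have : (1:ℝ)/9 ≤ t ^ 2 := by nlinarith
    have := mul_le_mul_of_nonneg_left this (sq_nonneg (T * (1 - t)))
    nlinarith
  -- integrals of the bounds
  obtain ⟨hEi, hEv⟩ := be_int_right T hT
  have hT2 : 0 < T ^ 2 / 2 := by positivity
  have gE : ∀ t, g t = Real.exp (-(T ^ 2 / 2) * t ^ 2) := by
    intro t; simp only [hg]; congr 1; ring
  have hgi : IntegrableOn g (Set.Ioi 0) := by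
    have := (integrable_exp_neg_mul_sq hT2).integrableOn (s := Set.Ioi 0)
    exact this.congr_fun (fun t _ => (gE t).symm) measurableSet_Ioi
  have hgv : ∫ t in Set.Ioi (0:ℝ), g t = ℓ / √(2 * π) := by
    simp only [gE]
    rw [integral_gaussian_Ioi]
    have h4 : 0 < √(2 * π) := by positivity
    have h5 : √(2 * π) ^ 2 = 2 * π := Real.sq_sqrt (by positivity)
    have : √(π / (T ^ 2 / 2)) = √(2 * π) / T := by
      rw [show π / (T ^ 2 / 2) = 2 * π / T ^ 2 by field_simp, Real.sqrt_div' _ (by positivity),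
        Real.sqrt_sq hT.le]
    rw [this, hTdef, div_div, div_eq_div_iff (by positivity) (by positivity)]
    rw [← sq, h5]
    field_simp
  have htgi : IntegrableOn (fun t => t * g t) (Set.Ioi 0) := by
    simp only [gE]; exact (be_int_t hT2).1
  have htgv : ∫ t in Set.Ioi (0:ℝ), t * g t = 1 / T ^ 2 := by
    simp only [gE]; rw [(be_int_t hT2).2]; field_simp
  have hb : 0 < 2 / 9 * T ^ 2 := by positivity
  have hDi : IntegrableOn D (Set.Ioi 0) := (be_int_t3 hb).1.const_mul C
  have hDv : ∫ t in Set.Ioi (0:ℝ), D t = L * Real.exp (1/2) / 8 * (81 / 8) := by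
    simp only [hD]
    rw [integral_const_mul, (be_int_t3 hb).2, hC]
    field_simp
    ring
  have hD0 : ∀ t, 0 < t → 0 ≤ D t := by
    intro t ht; simp only [hD]; positivity
  have hA : Set.Ioc (0:ℝ) (1/3) ⊆ Set.Ioi 0 := fun t ht => ht.1
  have hsplit : Set.Ioo (0:ℝ) 1 = Set.Ioc 0 (1/3) ∪ Set.Ioo (1/3) 1 := by
    rw [Set.Ioc_union_Ioo_eq_Ioo] <;> norm_num
  have hdisj : Disjoint (Set.Ioc (0:ℝ) (1/3)) (Set.Ioo (1/3) 1) := by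
    rw [Set.disjoint_left]; intro t h h'; exact absurd h.2 (not_le.2 h'.1)
  have hsplit2 : Set.Ioi (0:ℝ) = Set.Ioc 0 (1/3) ∪ Set.Ioi (1/3) := by
    rw [Set.Ioc_union_Ioi_eq_Ioi]; norm_num
  have hdisj2 : Disjoint (Set.Ioc (0:ℝ) (1/3)) (Set.Ioi (1/3)) := by
    rw [Set.disjoint_left]; intro t h h'; exact absurd h.2 (not_le.2 h')
  -- the three integrals
  have hpr := be_prawitz b T x hT
  have hG := be_gauss_inv_T x T hT Φ hΦ
  have hGi := be_gauss_sin_int x T hT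
  have hWi : IntegrableOn (fun t : ℝ => (1 - t) * (Real.cos (T * t * x) * f t)) (Set.Ioo 0 1) :=
    be_integrableOn_of_continuous _ (by fun_prop) _ _
  have hJi : IntegrableOn (fun t : ℝ => beq t * (Real.sin (T * t * x) * f t)) (Set.Ioo 0 1) := by
    have h := be_q_sin_int (T * x)
    have hbd : ∃ M, ∀ t ∈ Set.Icc (0:ℝ) 1, ‖f t‖ ≤ M :=
      isCompact_Icc.exists_bound_of_continuousOn hfc.continuousOn
    obtain ⟨M, hM⟩ := hbd
    have h' := Integrable.mul_bdd (c := M) h (g := f) hfc.aestronglyMeasurable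
      ((ae_restrict_mem measurableSet_Ioo).mono (fun t ht => hM t (Set.Ioo_subset_Icc_self ht)))
    refine IntegrableOn.congr_fun h' (fun t _ => ?_) measurableSet_Ioo
    rw [mul_assoc, show t * (T * x) = T * t * x by ring]
  set J := ∫ t in Set.Ioo (0:ℝ) 1, beq t * (Real.sin (T * t * x) * bf b (T * t)) with hJ
  set W := ∫ t in Set.Ioo (0:ℝ) 1, (1 - t) * (Real.cos (T * t * x) * bf b (T * t)) with hW
  have hWi' := hWi
  have hJi' := hJi
  have hGi' := hGi
  rw [hsplit] at hWi' hJi'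
  rw [hsplit2] at hGi'
  have hW2 : W = (∫ t in Set.Ioc (0:ℝ) (1/3), (1 - t) * (Real.cos (T * t * x) * f t)) +
      ∫ t in Set.Ioo (1/3:ℝ) 1, (1 - t) * (Real.cos (T * t * x) * f t) := by
    rw [hW, hsplit]
    exact setIntegral_union hdisj measurableSet_Ioo hWi'.left_of_union hWi'.right_of_union
  have hJ2 : J = (∫ t in Set.Ioc (0:ℝ) (1/3), beq t * (Real.sin (T * t * x) * f t)) +
      ∫ t in Set.Ioo (1/3:ℝ) 1, beq t * (Real.sin (T * t * x) * f t) := by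
    rw [hJ, hsplit]
    exact setIntegral_union hdisj measurableSet_Ioo hJi'.left_of_union hJi'.right_of_union
  have hG2 : Φ x - 1 / 2 = (∫ t in Set.Ioc (0:ℝ) (1/3), Real.sin (T * t * x) / (π * t) * g t) +
      ∫ t in Set.Ioi (1/3:ℝ), Real.sin (T * t * x) / (π * t) * g t := by
    rw [hG, hsplit2]
    exact setIntegral_union hdisj2 measurableSet_Ioi hGi'.left_of_union hGi'.right_of_union
  have b1 : |∫ t in Set.Ioc (0:ℝ) (1/3), (1 - t) * (Real.cos (T * t * x) * f t)| ≤
      ℓ / √(2 * π) + 1 / 3 * (L * Real.exp (1/2) / 8 * (81 / 8)) := by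
    have hi : IntegrableOn (fun t => g t + 1 / 3 * D t) (Set.Ioi 0) := hgi.add (hDi.const_mul _)
    refine (be_setIntegral_abs_le _ measurableSet_Ioc _ (fun t => g t + 1 / 3 * D t)
      (hi.mono_set hA) ?_).trans ?_
    · intro t ht
      have h5 := hfg t ht.1 ht.2
      have h6 := ht.1
      have h7 := ht.2
      have h8 : |(1 - t) * (Real.cos (T * t * x) * f t)| ≤ 1 * (1 * |f t|) := by
        rw [abs_mul, abs_mul]
        gcongr
        · rw [abs_le]; constructor <;> linarith
        · exact Real.abs_cos_le_one _
      have h9 : |f t| ≤ |f t - g t| + g t := by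
        have := abs_add_le (f t - g t) (g t)
        rwa [sub_add_cancel, abs_of_pos (hg0 t)] at this
      have h10 : t * D t ≤ 1 / 3 * D t := mul_le_mul_of_nonneg_right h7 (hD0 t h6)
      linarith
    · refine (be_setIntegral_le_Ioi _ hA _ hi ?_).trans (le_of_eq ?_)
      · intro t ht
        have := hD0 t ht
        have := hg0 t
        positivity
      · rw [integral_add hgi (hDi.const_mul _), integral_const_mul, hgv, hDv]
  have b2 : |∫ t in Set.Ioo (1/3:ℝ) 1, (1 - t) * (Real.cos (T * t * x) * f t)| ≤ 9 / T ^ 2 := by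
    refine (be_setIntegral_abs_le _ measurableSet_Ioo _ E hEi ?_).trans hEv
    intro t ht
    refine le_trans ?_ (hfB t ht.1.le ht.2)
    have h1 : 0 < 1 - t := by linarith [ht.2]
    rw [abs_mul, abs_of_pos h1, abs_mul]
    apply mul_le_mul_of_nonneg_left _ h1.le
    have := Real.abs_cos_le_one (T * t * x)
    nlinarith [abs_nonneg (f t)]
  have b3 : |∫ t in Set.Ioo (1/3:ℝ) 1, beq t * (Real.sin (T * t * x) * f t)| ≤ 5 / π * (9 / T ^ 2) := by
    refine (be_setIntegral_abs_le _ measurableSet_Ioo _ (fun t => 5 / π * E t) (hEi.const_mul _) ?_).trans ?_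
    · intro t ht
      have h0 := hfB t ht.1.le ht.2
      have h1 := be_q_nonneg t (by linarith [ht.1]) ht.2
      have h4 := be_q_le_right t ht.1.le ht.2
      rw [abs_mul, abs_of_nonneg h1, abs_mul]
      have h5 : |Real.sin (T * t * x)| * |f t| ≤ |f t| := by
        have := Real.abs_sin_le_one (T * t * x)
        nlinarith [abs_nonneg (f t)]
      calc beq t * (|Real.sin (T * t * x)| * |f t|) ≤ 5 / π * (1 - t) * |f t| := by
            apply mul_le_mul h4 h5 (by positivity) (h1.trans h4)
        _ = 5 / π * ((1 - t) * |f t|) := by ring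
        _ ≤ _ := by gcongr
    · rw [integral_const_mul]
      gcongr
  have b4 : |∫ t in Set.Ioi (1/3:ℝ), Real.sin (T * t * x) / (π * t) * g t| ≤ 9 / π * (1 / T ^ 2) := by
    have hB : Set.Ioi (1/3:ℝ) ⊆ Set.Ioi 0 := Set.Ioi_subset_Ioi (by norm_num)
    have hi : IntegrableOn (fun t => 9 / π * (t * g t)) (Set.Ioi 0) := htgi.const_mul _
    refine (be_setIntegral_abs_le _ measurableSet_Ioi _ (fun t => 9 / π * (t * g t))
      (hi.mono_set hB) ?_).trans ?_
    · intro t ht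
      have ht : 1 / 3 < t := ht
      have h0 : 0 < t := by linarith
      rw [abs_mul, abs_of_pos (hg0 t), ← mul_assoc]
      apply mul_le_mul_of_nonneg_right _ (hg0 t).le
      rw [abs_div, abs_of_pos (by positivity : 0 < π * t)]
      calc |Real.sin (T * t * x)| / (π * t) ≤ 1 / (π * t) := by
            gcongr; exact Real.abs_sin_le_one _
        _ ≤ 9 / π * t := by
            rw [div_le_iff₀ (by positivity)]
            have : 9 / π * t * (π * t) = 9 * t ^ 2 := by field_simp
            rw [this]; nlinarith
    · refine (be_setIntegral_le_Ioi _ hB _ hi ?_).trans (le_of_eq ?_)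
      · intro t ht
        have := hg0 t
        positivity
      · rw [integral_const_mul, htgv]
  have b5 : |(∫ t in Set.Ioc (0:ℝ) (1/3), beq t * (Real.sin (T * t * x) * f t)) -
      ∫ t in Set.Ioc (0:ℝ) (1/3), Real.sin (T * t * x) / (π * t) * g t| ≤
      1 / π * (L * Real.exp (1/2) / 8 * (81 / 8)) + π / 2 * (1 / T ^ 2) := by
    rw [← integral_sub hJi'.left_of_union hGi'.left_of_union]
    have hi : IntegrableOn (fun t => 1 / π * D t + π / 2 * (t * g t)) (Set.Ioi 0) :=
      (hDi.const_mul _).add (htgi.const_mul _)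
    refine (be_setIntegral_abs_le _ measurableSet_Ioc _ (fun t => 1 / π * D t + π / 2 * (t * g t))
      (hi.mono_set hA) ?_).trans ?_
    · intro t ht
      have h0 := ht.1
      have h1 := ht.2
      have hq0 := be_q_nonneg t h0 (by linarith)
      have hq1 := be_q_le t h0 (by linarith)
      have hq2 := be_q_ge t h0 (by linarith)
      have e : beq t * (Real.sin (T * t * x) * f t) - Real.sin (T * t * x) / (π * t) * g t =
          Real.sin (T * t * x) * (beq t * (f t - g t) - (1 / (π * t) - beq t) * g t) := by
        ring
      rw [e, abs_mul]
      have hs := Real.abs_sin_le_one (T * t * x)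
      have h4 : |beq t * (f t - g t) - (1 / (π * t) - beq t) * g t| ≤
          1 / π * D t + π / 2 * (t * g t) := by
        refine (abs_sub _ _).trans ?_
        rw [abs_mul, abs_mul, abs_of_nonneg hq0, abs_of_pos (hg0 t), abs_of_nonneg (sub_nonneg.2 hq1)]
        apply add_le_add
        · calc beq t * |f t - g t| ≤ 1 / (π * t) * (t * D t) :=
                mul_le_mul hq1 (hfg t h0 h1) (abs_nonneg _) (by positivity)
            _ = 1 / π * D t := by field_simp
        · rw [← mul_assoc]
          apply mul_le_mul_of_nonneg_right _ (hg0 t).le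
          linarith
      calc _ ≤ 1 * |beq t * (f t - g t) - (1 / (π * t) - beq t) * g t| :=
            mul_le_mul_of_nonneg_right hs (abs_nonneg _)
        _ ≤ _ := by rw [one_mul]; exact h4
    · refine (be_setIntegral_le_Ioi _ hA _ hi ?_).trans (le_of_eq ?_)
      · intro t ht
        have := hD0 t ht
        have := hg0 t
        positivity
      · have e1 : ∫ t in Set.Ioi (0:ℝ), 1 / π * D t = 1 / π * ∫ t in Set.Ioi (0:ℝ), D t :=
          integral_const_mul _ _
        rw [integral_add (hDi.const_mul _) (htgi.const_mul _), e1, hDv, integral_const_mul, htgv]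
  have fin1 : ℓ / √(2 * π) + L * (Real.exp (1/2) / 8 * (81 / 8) * (1 / 3 + 1 / π)) +
      ℓ ^ 2 * ((9 + 54 / π + π / 2) / π ^ 2) =
      ℓ / √(2 * π) + 1 / 3 * (L * Real.exp (1/2) / 8 * (81 / 8)) + 9 / T ^ 2 + 5 / π * (9 / T ^ 2) +
      9 / π * (1 / T ^ 2) + (1 / π * (L * Real.exp (1/2) / 8 * (81 / 8)) + π / 2 * (1 / T ^ 2)) := by
    have : 1 / T ^ 2 = ℓ ^ 2 / π ^ 2 := by rw [hTdef]; field_simp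
    have h9 : 9 / T ^ 2 = 9 * (1 / T ^ 2) := by ring
    rw [h9, this]
    generalize ℓ / √(2 * π) = z
    generalize Real.exp (1/2) = e
    field_simp
    ring
  rw [fin1]
  rw [abs_le] at b1 b2 b3 b4 b5 hpr ⊢
  constructor <;> linarith

theorem be_num_small (ℓ : ℝ) (hl : 0 < ℓ) (h : ℓ ≤ 0.4) :
    ℓ ^ ((4:ℝ)/3) * (Real.exp (1/2) / 8 * (81 / 8) * (1 / 3 + 1 / π)) +
      ℓ ^ 2 * ((9 + 54 / π + π / 2) / π ^ 2) ≤ 3.4106 * ℓ ^ ((4:ℝ)/3) := by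
  have hp1 := Real.pi_gt_d4
  have hp2 := Real.pi_lt_d4
  have hp := Real.pi_pos
  have he : Real.exp (1/2) ≤ 1.65 := by
    have h1 : Real.exp (1/2) ^ 2 = Real.exp 1 := by
      rw [← Real.exp_nat_mul]; norm_num
    have h2 := Real.exp_one_lt_d9
    have h3 := Real.exp_pos (1/2)
    by_contra hc
    push Not at hc
    nlinarith
  have hi : 1 / π ≤ 0.3184 := by
    rw [div_le_iff₀ hp]; nlinarith
  have hi0 : 0 < 1 / π := by positivity
  set M := ℓ ^ ((4:ℝ)/3) with hM
  set N := ℓ ^ ((2:ℝ)/3) with hN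
  have hM0 : 0 < M := by positivity
  have hN0 : 0 < N := by positivity
  have hMN : ℓ ^ 2 = M * N := by
    rw [hM, hN, ← Real.rpow_add hl, ← Real.rpow_natCast]; norm_num
  have hN3 : N ^ 3 = ℓ ^ 2 := by
    rw [hN, ← Real.rpow_natCast, ← Real.rpow_mul hl.le, ← Real.rpow_natCast]; norm_num
  have hNle : N ≤ 0.55 := by
    by_contra hc
    push Not at hc
    have h1 : (0.55:ℝ) ^ 3 < N ^ 3 := by gcongr
    rw [hN3] at h1
    norm_num at h1 h
    nlinarith
  have hA : Real.exp (1/2) / 8 * (81 / 8) * (1 / 3 + 1 / π) ≤ 1.37 := by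
    have : Real.exp (1/2) / 8 * (81 / 8) * (1 / 3 + 1 / π) ≤ 1.65 / 8 * (81 / 8) * (1 / 3 + 0.3184) := by
      gcongr
    refine this.trans ?_
    norm_num
  have hB : (9 + 54 / π + π / 2) / π ^ 2 ≤ 3 := by
    have h1 : 54 / π ≤ 54 * 0.3184 := by
      have : 54 / π = 54 * (1 / π) := by ring
      rw [this]; gcongr
    rw [div_le_iff₀ (by positivity)]
    nlinarith
  have hB0 : 0 ≤ (9 + 54 / π + π / 2) / π ^ 2 := by positivity
  rw [hMN, mul_assoc M N, ← mul_add, mul_comm _ M]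
  apply mul_le_mul_of_nonneg_left _ hM0.le
  have : N * ((9 + 54 / π + π / 2) / π ^ 2) ≤ 0.55 * 3 := mul_le_mul hNle hB hB0 (by norm_num)
  norm_num at this hA ⊢
  linarith

theorem be_num_large (ℓ : ℝ) (h : 0.4 ≤ ℓ) : 1 ≤ 3.4106 * ℓ ^ ((4:ℝ)/3) := by
  have hl : 0 < ℓ := by norm_num at h; linarith
  set M := ℓ ^ ((4:ℝ)/3) with hM
  have hM0 : 0 < M := by positivity
  have hM3 : M ^ 3 = ℓ ^ 4 := by
    rw [hM, ← Real.rpow_natCast, ← Real.rpow_mul hl.le, ← Real.rpow_natCast]; norm_num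
  have h4 : (0.4:ℝ) ^ 4 ≤ ℓ ^ 4 := by gcongr
  by_contra hc
  push Not at hc
  have hM1 : M < 0.2935 := by norm_num at hc ⊢; linarith
  have h5 : M ^ 3 < 0.2935 ^ 3 := by gcongr
  rw [hM3] at h5
  norm_num at h4 h5
  linarith

theorem be_unifPr_mem (n : ℕ) (E : (Fin n → Bool) → Prop) : 0 ≤ unifPr n E ∧ unifPr n E ≤ 1 := by
  unfold unifPr
  constructor
  · positivity
  · rw [div_le_one (by positivity)]
    have h := Finset.card_filter_le (Finset.univ : Finset (Fin n → Bool)) E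
    have h2 : (Finset.univ : Finset (Fin n → Bool)).card = 2 ^ n := by simp
    rw [h2] at h
    exact_mod_cast h

theorem be_Phi_mem (x : ℝ) : 0 ≤ (1 / √(2 * π)) * ∫ t in Set.Iio x, Real.exp (-t ^ 2 / 2) ∧
    (1 / √(2 * π)) * ∫ t in Set.Iio x, Real.exp (-t ^ 2 / 2) ≤ 1 := by
  have hp := Real.pi_pos
  have e : ∀ t : ℝ, Real.exp (-t ^ 2 / 2) = Real.exp (-(1/2) * t ^ 2) := by
    intro t; congr 1; ring
  simp only [e]
  have hi : Integrable (fun t : ℝ => Real.exp (-(1/2) * t ^ 2)) :=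
    integrable_exp_neg_mul_sq (by norm_num)
  have hv : ∫ t : ℝ, Real.exp (-(1/2) * t ^ 2) = √(2 * π) := by
    rw [integral_gaussian]; congr 1; ring
  have h0 : 0 ≤ ∫ t in Set.Iio x, Real.exp (-(1/2) * t ^ 2) :=
    integral_nonneg (fun t => (Real.exp_pos _).le)
  have h1 : ∫ t in Set.Iio x, Real.exp (-(1/2) * t ^ 2) ≤ √(2 * π) := by
    rw [← hv]
    exact setIntegral_le_integral hi (Filter.Eventually.of_forall (fun t => (Real.exp_pos _).le))
  constructor
  · positivity
  · rw [div_mul_eq_mul_div, one_mul, div_le_one (by positivity)]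
    exact h1

/-- Shevtsova's optimal Berry–Esseen theorem for symmetric
Bernoulli (Rademacher) sums. -/
theorem shevtsova_berry_esseen (n : ℕ) (a : Fin n → ℝ) (ha : a ≠ 0)
    (σ ℓ : ℝ) (hσ : σ = Real.sqrt (∑ j, a j ^ 2))
    (hℓ : ℓ = (∑ j, |a j| ^ 3) / σ ^ 3)
    (Φ : ℝ → ℝ)
    (hΦ : ∀ x : ℝ, Φ x = (1 / Real.sqrt (2 * Real.pi)) * ∫ t in Set.Iio x, Real.exp (-t ^ 2 / 2)) :
    ∀ x : ℝ, |unifPr n (fun ε => ∑ j, a j * pm (ε j) < x * σ) - Φ x| ≤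
      ℓ / Real.sqrt (2 * Real.pi) + 3.4106 * ℓ ^ ((4 : ℝ) / 3) := by
  intro x
  obtain ⟨i, hi⟩ : ∃ i, a i ≠ 0 := by
    by_contra hc
    push Not at hc
    exact ha (funext hc)
  have hS : 0 < ∑ j, a j ^ 2 :=
    Finset.sum_pos' (fun j _ => sq_nonneg _) ⟨i, Finset.mem_univ _, by positivity⟩
  have hσ0 : 0 < σ := by rw [hσ]; exact Real.sqrt_pos.2 hS
  have hσ2 : σ ^ 2 = ∑ j, a j ^ 2 := by rw [hσ]; exact Real.sq_sqrt hS.le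
  have hS3 : 0 < ∑ j, |a j| ^ 3 :=
    Finset.sum_pos' (fun j _ => by positivity) ⟨i, Finset.mem_univ _, by positivity⟩
  have hl0 : 0 < ℓ := by rw [hℓ]; positivity
  have h2 : ∑ j, (fun j => a j / σ) j ^ 2 = 1 := by
    simp only [div_pow]
    rw [← Finset.sum_div, ← hσ2]
    exact div_self (by positivity)
  have h3 : ∑ j, |(fun j => a j / σ) j| ^ 3 = ℓ := by
    simp only [abs_div, div_pow, abs_of_pos hσ0]
    rw [← Finset.sum_div, hℓ]
  have hev : (fun ε : Fin n → Bool => ∑ j, a j * pm (ε j) < x * σ) =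
      (fun ε => bS (fun j => a j / σ) ε < x) := by
    funext ε
    have : bS (fun j => a j / σ) ε = (∑ j, a j * pm (ε j)) / σ := by
      unfold bS
      rw [Finset.sum_div]
      exact Finset.sum_congr rfl (fun j _ => by ring)
    rw [this, div_lt_iff₀ hσ0]
  rcases le_total ℓ 0.4 with h | h
  · have hm := be_main (fun j => a j / σ) ℓ x h2 h3 hl0 Φ hΦ
    rw [hev]
    have := be_num_small ℓ hl0 h
    linarith
  · have h5 := be_num_large ℓ h
    obtain ⟨p0, p1⟩ := be_unifPr_mem n (fun ε => ∑ j, a j * pm (ε j) < x * σ)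
    have hq := be_Phi_mem x
    rw [← hΦ x] at hq
    have h6 : 0 ≤ ℓ / Real.sqrt (2 * Real.pi) := by positivity
    rw [abs_le]
    constructor <;> linarith [hq.1, hq.2]
end
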